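/- arXiv:1804.07076 — 3 statements merged into one kernel-verified Lean document; each statement's English description precedes it below -/
import Mathlib

section
/- For all real α, β > −1 and every T > 0 there exist constants C > 0 and N ∈ ℕ such that for all n ≥ N and all θ ∈ (0, T/κ], writing κ = n + (α+β+1)/2 and G = Γ(n+α+1)/(n! κ^α), one has |(sin(θ/2))^α (cos(θ/2))^β √(sin θ/θ) · P_n^{(α,β)}(cos θ) − G·[J_α(κθ) + A₁(θ) J_{α+1}(κθ)/κ]| ≤ C/κ², where A₁(θ) = ((4α² − 1)(sin θ − θ cos θ) + 2θ(α² − β²)(cos θ − 1))/(8θ sin θ) and J_ν(x) = Σ_{m=0}^∞ ((−1)^m/(m! Γ(m+ν+1)))(x/2)^{2m+ν}. -/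
open Real

/-- The Jacobi polynomial `P_n^{(α,β)}(x)` defined by its explicit sum. -/
noncomputable def jacobiP (α β : ℝ) (n : ℕ) (x : ℝ) : ℝ :=
  ∑ ℓ ∈ Finset.range (n + 1),
    ((ascPochhammer ℝ ℓ).eval ((n : ℝ) + α + β + 1) *
        (ascPochhammer ℝ (n - ℓ)).eval (α + (ℓ : ℝ) + 1)) /
      ((Nat.factorial ℓ : ℝ) * (Nat.factorial (n - ℓ) : ℝ)) * ((x - 1) / 2) ^ ℓ

/-- The Bessel function of the first kind, defined by its power series (via `rpow`). -/
noncomputable def besselJ (ν x : ℝ) : ℝ :=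
  ∑' m : ℕ, ((-1 : ℝ) ^ m / ((Nat.factorial m : ℝ) * Real.Gamma ((m : ℝ) + ν + 1))) *
    (x / 2) ^ (2 * (m : ℝ) + ν)

open Filter Topology

section GammaQuotients

theorem Gamma_add_natCast_eq_ascPochhammer_mul {x : ℝ} (hx : 0 < x) (m : ℕ) :
    Real.Gamma (x + m) = (ascPochhammer ℝ m).eval x * Real.Gamma x := by
  induction m with
  | zero => simp
  | succ m ih =>
    have hxm : x + m ≠ 0 := by positivity
    rw [ascPochhammer_succ_eval, Nat.cast_succ, ← add_assoc, Real.Gamma_add_one hxm, ih]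
    ring

theorem GammaSeq_mul_Gamma_add {s : ℝ} (hs : 0 < s) (n : ℕ) :
    Real.GammaSeq s n * Real.Gamma (s + n + 1) = (n : ℝ) ^ s * (n.factorial : ℝ) * Real.Gamma s := by
  have h : ∀ m : ℕ, Real.Gamma (s + m) = (∏ j ∈ Finset.range m, (s + j)) * Real.Gamma s := by
    intro m
    induction m with
    | zero => simp
    | succ m ih =>
      have hsm : s + m ≠ 0 := by positivity
      rw [Finset.prod_range_succ, Nat.cast_succ, ← add_assoc, Real.Gamma_add_one hsm, ih]
      ring
  have hprod : ∏ j ∈ Finset.range (n + 1), (s + (j : ℝ)) ≠ 0 :=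
    Finset.prod_ne_zero_iff.2 fun j _ => by positivity
  have h' := h (n + 1)
  rw [Nat.cast_succ, ← add_assoc] at h'
  rw [Real.GammaSeq, h']
  field_simp

/-- The quotient `Γ(n+α+1) / (n! (n+c)^α)` tends to `1`. -/
theorem tendsto_Gamma_div_factorial_mul_rpow {α : ℝ} (hα : -1 < α) (c : ℝ) :
    Tendsto (fun n : ℕ => Real.Gamma ((n : ℝ) + α + 1) /
      ((n.factorial : ℝ) * ((n : ℝ) + c) ^ α)) atTop (𝓝 1) := by
  have hΓ : Real.Gamma (α + 1) ≠ 0 := (Real.Gamma_pos_of_pos (by linarith)).ne'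
  have hquot : ∀ d : ℝ, Tendsto (fun n : ℕ => (n : ℝ) / ((n : ℝ) + d)) atTop (𝓝 1) :=
    fun d => tendsto_natCast_div_add_atTop d
  have h₁ : Tendsto (fun n : ℕ => (n : ℝ) / ((n : ℝ) + (α + 1)) *
      (Real.Gamma (α + 1) / Real.GammaSeq (α + 1) n) * ((n : ℝ) / ((n : ℝ) + c)) ^ α)
      atTop (𝓝 (1 * (Real.Gamma (α + 1) / Real.Gamma (α + 1)) * 1 ^ α)) :=
    ((hquot (α + 1)).mul (tendsto_const_nhds.div (Real.GammaSeq_tendsto_Gamma _) hΓ)).mul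
      ((hquot c).rpow_const (Or.inl one_ne_zero))
  rw [div_self hΓ, Real.one_rpow, one_mul, one_mul] at h₁
  refine h₁.congr' ?_
  have hlarge : ∀ᶠ n : ℕ in atTop, -c < (n : ℝ) :=
    tendsto_natCast_atTop_atTop.eventually_gt_atTop (-c)
  filter_upwards [hlarge, eventually_gt_atTop 0] with n hnc hn
  have hn' : (0 : ℝ) < n := Nat.cast_pos.2 hn
  have hκ : (0 : ℝ) < n + c := by linarith
  have hs : 0 < α + 1 := by linarith
  have hsn : 0 < (n : ℝ) + α + 1 := by linarith
  have hseq := GammaSeq_mul_Gamma_add hs n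
  have hG : Real.Gamma (α + 1 + n + 1) = ((n : ℝ) + α + 1) * Real.Gamma ((n : ℝ) + α + 1) := by
    rw [← Real.Gamma_add_one hsn.ne']
    ring_nf
  rw [hG, Real.rpow_add_one hn'.ne'] at hseq
  have hΓn : 0 < Real.Gamma ((n : ℝ) + α + 1) := Real.Gamma_pos_of_pos hsn
  have hnα : 0 < (n : ℝ) ^ α := Real.rpow_pos_of_pos hn' α
  have hκα : 0 < ((n : ℝ) + c) ^ α := Real.rpow_pos_of_pos hκ α
  have hfac : (0 : ℝ) < n.factorial := Nat.cast_pos.2 n.factorial_pos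
  have hseq0 : Real.GammaSeq (α + 1) n ≠ 0 := by
    intro h0
    rw [h0, zero_mul] at hseq
    have : (n : ℝ) ^ α * n * n.factorial * Real.Gamma (α + 1) ≠ 0 := by positivity
    exact this hseq.symm
  rw [Real.div_rpow hn'.le hκ.le, ← add_assoc]
  field_simp
  linear_combination -hseq

end GammaQuotients

section BesselSeries

/-- The modulus of the `m`-th coefficient of the power series of `(x/2)^{-ν} J_ν(x)`
in the variable `(x/2)^2`. -/
noncomputable def besselCoeff (ν : ℝ) (m : ℕ) : ℝ :=
  1 / ((m.factorial : ℝ) * Real.Gamma ((m : ℝ) + ν + 1))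

variable {ν : ℝ}

theorem besselCoeff_pos (hν : -1 < ν) (m : ℕ) : 0 < besselCoeff ν m := by
  have hm : (0 : ℝ) ≤ m := m.cast_nonneg
  have := Real.Gamma_pos_of_pos (show 0 < (m : ℝ) + ν + 1 by linarith)
  unfold besselCoeff
  positivity

theorem summable_besselCoeff_mul_pow (hν : -1 < ν) {r : ℝ} (hr : 0 ≤ r) :
    Summable fun m => besselCoeff ν m * r ^ m := by
  refine Summable.of_norm_bounded_eventually_nat (Real.summable_pow_div_factorial r) ?_
  filter_upwards [eventually_ge_atTop 2] with m hm
  have hm' : (2 : ℝ) ≤ m := by exact_mod_cast hm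
  have hΓ : 1 ≤ Real.Gamma ((m : ℝ) + ν + 1) := by
    have hm2 : 2 ≤ (m : ℝ) + ν + 1 := by linarith
    exact Real.Gamma_two.ge.trans
      (Real.Gamma_strictMonoOn_Ici.monotoneOn Set.self_mem_Ici hm2 hm2)
  rw [Real.norm_of_nonneg (mul_nonneg (besselCoeff_pos hν m).le (pow_nonneg hr m)), besselCoeff,
    one_div_mul_eq_div]
  gcongr
  exact le_mul_of_one_le_right (by positivity) hΓ

theorem besselJ_eq_rpow_mul_tsum (ν : ℝ) {x : ℝ} (hx : 0 < x) :
    besselJ ν x = (x / 2) ^ ν * ∑' m : ℕ, besselCoeff ν m * ((-1) ^ m * ((x / 2) ^ 2) ^ m) := by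
  rw [besselJ, ← tsum_mul_left]
  refine tsum_congr fun m => ?_
  have hpow : (x / 2) ^ (2 * (m : ℝ) + ν) = ((x / 2) ^ 2) ^ m * (x / 2) ^ ν := by
    rw [Real.rpow_add (by positivity), ← pow_mul, ← Real.rpow_natCast]
    push_cast
    rfl
  rw [hpow, besselCoeff]
  ring

theorem abs_besselJ_le (hν : -1 < ν) {x M : ℝ} (hx : 0 < x) (hM : (x / 2) ^ 2 ≤ M) :
    |besselJ ν x| ≤ (x / 2) ^ ν * ∑' m : ℕ, besselCoeff ν m * M ^ m := by
  have hM0 : 0 ≤ M := (sq_nonneg _).trans hM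
  rw [besselJ_eq_rpow_mul_tsum ν hx, abs_mul, abs_of_pos (by positivity : 0 < (x / 2) ^ ν)]
  gcongr
  rw [← Real.norm_eq_abs]
  refine tsum_of_norm_bounded (summable_besselCoeff_mul_pow hν hM0).hasSum fun m => ?_
  rw [norm_mul, norm_mul, norm_pow, norm_neg, norm_one, one_pow, one_mul,
    Real.norm_of_nonneg (besselCoeff_pos hν m).le, Real.norm_of_nonneg (by positivity)]
  have := (besselCoeff_pos hν m).le
  gcongr

end BesselSeries

section DampedSeries

/-- The product `∏_{j<ℓ} (1 - (j+c)²/κ²)` which distinguishes the coefficients of a Jacobi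
polynomial from those of a Bessel function. -/
noncomputable def dampingFactor (c κ : ℝ) (ℓ : ℕ) : ℝ :=
  ∏ j ∈ Finset.range ℓ, (1 - ((j : ℝ) + c) ^ 2 / κ ^ 2)

theorem dampingFactor_succ (c κ : ℝ) (ℓ : ℕ) :
    dampingFactor c κ (ℓ + 1) = dampingFactor c κ ℓ * (1 - ((ℓ : ℝ) + c) ^ 2 / κ ^ 2) :=
  Finset.prod_range_succ _ _

variable {c : ℝ} {n : ℕ}

theorem dampingFactor_eq_zero_of_lt (hκ : 0 < (n : ℝ) + c) {ℓ : ℕ} (h : n < ℓ) :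
    dampingFactor c (n + c) ℓ = 0 := by
  refine Finset.prod_eq_zero (Finset.mem_range.2 h) ?_
  rw [div_self (by positivity), sub_self]

theorem dampingFactor_mem_Icc (hn : 1 ≤ n) (hc : -1 < 2 * c) (ℓ : ℕ) :
    dampingFactor c (n + c) ℓ ∈ Set.Icc (0 : ℝ) 1 := by
  have hn' : (1 : ℝ) ≤ n := by exact_mod_cast hn
  have hκ : 0 < (n : ℝ) + c := by linarith
  induction ℓ with
  | zero => simp [dampingFactor]
  | succ ℓ ih =>
    rcases le_or_gt ℓ n with hℓ | hℓ
    · have hℓ' : (ℓ : ℝ) ≤ n := by exact_mod_cast hℓ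
      have hℓ0 : (0 : ℝ) ≤ ℓ := ℓ.cast_nonneg
      have h₁ : ((ℓ : ℝ) + c) ^ 2 / (n + c) ^ 2 ≤ 1 := by
        rw [div_le_one (by positivity)]
        exact sq_le_sq' (by linarith) (by linarith)
      have h₀ : 0 ≤ ((ℓ : ℝ) + c) ^ 2 / (n + c) ^ 2 := by positivity
      rw [dampingFactor_succ]
      exact ⟨mul_nonneg ih.1 (by linarith), mul_le_one₀ ih.2 (by linarith) (by linarith)⟩
    · rw [dampingFactor_succ, dampingFactor_eq_zero_of_lt hκ hℓ]
      simp

theorem one_sub_dampingFactor_le (hn : 1 ≤ n) (hc : -1 < 2 * c) (ℓ : ℕ) :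
    1 - dampingFactor c (n + c) ℓ ≤ ℓ * ((ℓ : ℝ) + |c|) ^ 2 / (n + c) ^ 2 := by
  induction ℓ with
  | zero => simp [dampingFactor]
  | succ ℓ ih =>
    have hmem := dampingFactor_mem_Icc hn hc ℓ
    have hsq : ((ℓ : ℝ) + c) ^ 2 ≤ ((ℓ : ℝ) + 1 + |c|) ^ 2 := by
      have hℓ0 : (0 : ℝ) ≤ ℓ := ℓ.cast_nonneg
      exact sq_le_sq' (by linarith [neg_abs_le c]) (by linarith [le_abs_self c])
    have hfac : dampingFactor c (n + c) ℓ * (((ℓ : ℝ) + c) ^ 2 / (n + c) ^ 2) ≤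
        ((ℓ : ℝ) + 1 + |c|) ^ 2 / (n + c) ^ 2 :=
      (mul_le_of_le_one_left (by positivity) hmem.2).trans (by gcongr)
    have hmono : ℓ * ((ℓ : ℝ) + |c|) ^ 2 / (n + c) ^ 2 ≤
        ℓ * ((ℓ : ℝ) + 1 + |c|) ^ 2 / (n + c) ^ 2 := by
      gcongr
      linarith
    rw [dampingFactor_succ, Nat.cast_succ]
    have hsplit : ((ℓ : ℝ) + 1) * ((ℓ : ℝ) + 1 + |c|) ^ 2 / (n + c) ^ 2 =
        ℓ * ((ℓ : ℝ) + 1 + |c|) ^ 2 / (n + c) ^ 2 + ((ℓ : ℝ) + 1 + |c|) ^ 2 / (n + c) ^ 2 := by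
      ring
    rw [hsplit]
    linarith

theorem abs_pow_mul_dampingFactor_sub_pow_le (hn : 1 ≤ n) (hc : -1 < 2 * c) {y Y M : ℝ}
    (hy : 0 ≤ y) (hyY : y ≤ Y) (hYM : Y ≤ M) (hM : 1 ≤ M)
    (hclose : Y - y ≤ M * Y / (n + c) ^ 2) (ℓ : ℕ) :
    |y ^ ℓ * dampingFactor c (n + c) ℓ - Y ^ ℓ| ≤
      Y / (n + c) ^ 2 * ((1 + |c|) ^ 2 + 1) * (8 * M) ^ ℓ := by
  have hY : 0 ≤ Y := hy.trans hyY
  have hmem := dampingFactor_mem_Icc hn hc ℓ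
  have hle : y ^ ℓ * dampingFactor c (n + c) ℓ ≤ Y ^ ℓ :=
    (mul_le_of_le_one_right (by positivity) hmem.2).trans (by gcongr)
  rw [abs_sub_comm, abs_of_nonneg (by linarith)]
  rcases ℓ with _ | k
  · simp only [pow_zero, mul_one, dampingFactor, Finset.range_zero, Finset.prod_empty,
      sub_self]
    positivity
  set ℓ := k + 1 with hℓ
  have hpow_le : Y ^ ℓ ≤ Y * M ^ ℓ := by
    rw [hℓ, pow_succ', pow_succ M]
    have : Y ^ k ≤ M ^ k := by gcongr
    have : M ^ k ≤ M ^ k * M := le_mul_of_one_le_right (by positivity) hM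
    gcongr
    linarith
  have hdamp : y ^ ℓ * (1 - dampingFactor c (n + c) ℓ) ≤
      Y * M ^ ℓ * (ℓ * ((ℓ : ℝ) + |c|) ^ 2 / (n + c) ^ 2) := by
    have h0 : 0 ≤ 1 - dampingFactor c (n + c) ℓ := by linarith [hmem.2]
    have h1 := one_sub_dampingFactor_le hn hc ℓ
    have h2 : y ^ ℓ ≤ Y * M ^ ℓ := le_trans (by gcongr) hpow_le
    exact mul_le_mul h2 h1 h0 (by positivity)
  have hdiff : Y ^ ℓ - y ^ ℓ ≤ Y * M ^ ℓ * (ℓ / (n + c) ^ 2) := by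
    have h0 := abs_pow_sub_pow_le Y y ℓ
    rw [max_eq_left (by rwa [abs_of_nonneg hY, abs_of_nonneg hy]), abs_of_nonneg hY,
      abs_of_nonneg (sub_nonneg.2 hyY), show ℓ - 1 = k by omega] at h0
    calc Y ^ ℓ - y ^ ℓ ≤ (Y - y) * ℓ * Y ^ k := (le_abs_self _).trans h0
      _ ≤ (M * Y / (n + c) ^ 2) * ℓ * M ^ k := by gcongr
      _ = Y * M ^ ℓ * (ℓ / (n + c) ^ 2) := by rw [hℓ, pow_succ]; ring
  have h2 : (1 : ℝ) ≤ 2 ^ ℓ := one_le_pow₀ (by norm_num)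
  have hℓ2 : (ℓ : ℝ) ≤ 2 ^ ℓ := by exact_mod_cast (Nat.lt_two_pow_self (n := ℓ)).le
  have h8 : (8 : ℝ) ^ ℓ = 2 ^ ℓ * (2 ^ ℓ) ^ 2 := by
    rw [← pow_mul, mul_comm ℓ 2, pow_mul, ← mul_pow]; norm_num
  have hweight : (ℓ : ℝ) * ((ℓ : ℝ) + |c|) ^ 2 + ℓ ≤ ((1 + |c|) ^ 2 + 1) * 8 ^ ℓ := by
    have ha : (ℓ : ℝ) + |c| ≤ (1 + |c|) * 2 ^ ℓ := by nlinarith [abs_nonneg c]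
    calc (ℓ : ℝ) * ((ℓ : ℝ) + |c|) ^ 2 + ℓ
        ≤ 2 ^ ℓ * ((1 + |c|) * 2 ^ ℓ) ^ 2 + 2 ^ ℓ * (2 ^ ℓ) ^ 2 := by
          gcongr
          exact hℓ2.trans (le_mul_of_one_le_right (by positivity) (one_le_pow₀ h2))
      _ = ((1 + |c|) ^ 2 + 1) * 8 ^ ℓ := by rw [h8]; ring
  calc Y ^ ℓ - y ^ ℓ * dampingFactor c (n + c) ℓ
      = y ^ ℓ * (1 - dampingFactor c (n + c) ℓ) + (Y ^ ℓ - y ^ ℓ) := by ring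
    _ ≤ Y * M ^ ℓ * (ℓ * ((ℓ : ℝ) + |c|) ^ 2 / (n + c) ^ 2) +
        Y * M ^ ℓ * (ℓ / (n + c) ^ 2) := add_le_add hdamp hdiff
    _ = Y / (n + c) ^ 2 * M ^ ℓ * ((ℓ : ℝ) * ((ℓ : ℝ) + |c|) ^ 2 + ℓ) := by ring
    _ ≤ Y / (n + c) ^ 2 * M ^ ℓ * (((1 + |c|) ^ 2 + 1) * 8 ^ ℓ) := by gcongr
    _ = Y / (n + c) ^ 2 * ((1 + |c|) ^ 2 + 1) * (8 * M) ^ ℓ := by rw [mul_pow]; ring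

end DampedSeries

section JacobiSum

theorem ascPochhammer_eval_mul_factorial {c : ℝ} {n : ℕ} (hκ : (n : ℝ) + c ≠ 0) {ℓ : ℕ}
    (hℓ : ℓ ≤ n) :
    (ascPochhammer ℝ ℓ).eval ((n : ℝ) + 2 * c) * (n.factorial : ℝ) =
      ((n - ℓ).factorial : ℝ) * (((n : ℝ) + c) ^ 2) ^ ℓ * dampingFactor c (n + c) ℓ := by
  induction ℓ with
  | zero => simp [dampingFactor]
  | succ ℓ ih =>
    have hfac : ((n - ℓ).factorial : ℝ) = ((n : ℝ) - ℓ) * ((n - (ℓ + 1)).factorial : ℝ) := by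
      rw [← Nat.cast_sub (by omega), ← Nat.cast_mul, show n - ℓ = n - (ℓ + 1) + 1 by omega,
        Nat.factorial_succ]
    rw [ascPochhammer_succ_eval, dampingFactor_succ, mul_right_comm, ih (by omega), hfac, pow_succ]
    field_simp
    ring

theorem jacobiP_eq_Gamma_mul_sum {α β : ℝ} (hα : -1 < α) {n : ℕ}
    (hκ : (n : ℝ) + (α + β + 1) / 2 ≠ 0) (x : ℝ) :
    jacobiP α β n x = Real.Gamma ((n : ℝ) + α + 1) / (n.factorial : ℝ) *
      ∑ ℓ ∈ Finset.range (n + 1), besselCoeff α ℓ * ((-1) ^ ℓ *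
        ((((n : ℝ) + (α + β + 1) / 2) ^ 2 * ((1 - x) / 2)) ^ ℓ *
          dampingFactor ((α + β + 1) / 2) (n + (α + β + 1) / 2) ℓ)) := by
  rw [jacobiP, Finset.mul_sum]
  refine Finset.sum_congr rfl fun ℓ hℓ => ?_
  have hℓn : ℓ ≤ n := Nat.lt_succ_iff.1 (Finset.mem_range.1 hℓ)
  have h₁ := ascPochhammer_eval_mul_factorial hκ hℓn
  rw [show (n : ℝ) + 2 * ((α + β + 1) / 2) = n + α + β + 1 by ring] at h₁
  have hpos : 0 < α + (ℓ : ℝ) + 1 := by linarith [(Nat.cast_nonneg ℓ : (0 : ℝ) ≤ ℓ)]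
  have h₂ := Gamma_add_natCast_eq_ascPochhammer_mul hpos (n - ℓ)
  rw [Nat.cast_sub hℓn, show α + (ℓ : ℝ) + 1 + (n - ℓ) = n + α + 1 by ring] at h₂
  have hΓ := (Real.Gamma_pos_of_pos hpos).ne'
  have hn : (n.factorial : ℝ) ≠ 0 := by positivity
  have hnℓ : ((n - ℓ).factorial : ℝ) ≠ 0 := by positivity
  have hℓf : (ℓ.factorial : ℝ) ≠ 0 := by positivity
  rw [h₂, eq_div_of_mul_eq hn h₁, besselCoeff, show (ℓ : ℝ) + α + 1 = α + ℓ + 1 by ring,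
    show (x - 1) / 2 = -1 * ((1 - x) / 2) by ring, mul_pow, mul_pow]
  field_simp

end JacobiSum

section SeriesComparison

variable {ν c : ℝ} {n : ℕ} {y Y M : ℝ}

theorem abs_damped_sum_le (hν : -1 < ν) (hn : 1 ≤ n) (hc : -1 < 2 * c)
    (hy : 0 ≤ y) (hyM : y ≤ M) :
    |∑ ℓ ∈ Finset.range (n + 1), besselCoeff ν ℓ * ((-1) ^ ℓ *
      (y ^ ℓ * dampingFactor c (n + c) ℓ))| ≤ ∑' m, besselCoeff ν m * M ^ m := by
  have hM : 0 ≤ M := hy.trans hyM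
  refine (Finset.abs_sum_le_sum_abs _ _).trans ?_
  refine le_trans (Finset.sum_le_sum fun ℓ _ => ?_)
    ((summable_besselCoeff_mul_pow hν hM).sum_le_tsum (Finset.range (n + 1))
      fun m _ => mul_nonneg (besselCoeff_pos hν m).le (by positivity))
  have hmem := dampingFactor_mem_Icc hn hc ℓ
  have hb := besselCoeff_pos hν ℓ
  rw [abs_mul, abs_mul, abs_pow, abs_neg, abs_one, one_pow, one_mul, abs_of_pos hb,
    abs_of_nonneg (mul_nonneg (by positivity) hmem.1)]
  gcongr
  exact (mul_le_of_le_one_right (by positivity) hmem.2).trans (by gcongr)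

theorem abs_damped_sum_sub_tsum_le (hν : -1 < ν) (hn : 1 ≤ n) (hc : -1 < 2 * c)
    (hy : 0 ≤ y) (hyY : y ≤ Y) (hYM : Y ≤ M) (hM : 1 ≤ M)
    (hclose : Y - y ≤ M * Y / (n + c) ^ 2) :
    |∑ ℓ ∈ Finset.range (n + 1), besselCoeff ν ℓ * ((-1) ^ ℓ *
        (y ^ ℓ * dampingFactor c (n + c) ℓ)) -
      ∑' ℓ : ℕ, besselCoeff ν ℓ * ((-1) ^ ℓ * Y ^ ℓ)| ≤
      Y / (n + c) ^ 2 * ((1 + |c|) ^ 2 + 1) * ∑' m, besselCoeff ν m * (8 * M) ^ m := by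
  have hn' : (1 : ℝ) ≤ n := by exact_mod_cast hn
  have hκ : 0 < (n : ℝ) + c := by linarith
  have hY : 0 ≤ Y := hy.trans hyY
  have hsum₁ : HasSum (fun ℓ : ℕ => besselCoeff ν ℓ * ((-1) ^ ℓ *
      (y ^ ℓ * dampingFactor c (n + c) ℓ)))
      (∑ ℓ ∈ Finset.range (n + 1), besselCoeff ν ℓ * ((-1) ^ ℓ *
        (y ^ ℓ * dampingFactor c (n + c) ℓ))) := by
    refine hasSum_sum_of_ne_finset_zero fun ℓ hℓ => ?_
    rw [dampingFactor_eq_zero_of_lt hκ (by simpa using hℓ)]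
    simp
  have hsum₂ : Summable fun ℓ : ℕ => besselCoeff ν ℓ * ((-1) ^ ℓ * Y ^ ℓ) := by
    refine Summable.of_norm_bounded (summable_besselCoeff_mul_pow hν hY) fun ℓ => ?_
    rw [norm_mul, norm_mul, norm_pow, norm_neg, norm_one, one_pow, one_mul,
      Real.norm_of_nonneg (besselCoeff_pos hν ℓ).le, Real.norm_of_nonneg (by positivity)]
  rw [← (hsum₁.sub hsum₂.hasSum).tsum_eq, ← Real.norm_eq_abs]
  refine tsum_of_norm_bounded (((summable_besselCoeff_mul_pow hν
    (by positivity : 0 ≤ 8 * M)).hasSum).mul_left _) fun ℓ => ?_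
  have hb := besselCoeff_pos hν ℓ
  rw [← mul_sub, ← mul_sub, Real.norm_eq_abs, abs_mul, abs_mul, abs_pow, abs_neg, abs_one, one_pow,
    one_mul, abs_of_pos hb, mul_left_comm]
  gcongr
  exact abs_pow_mul_dampingFactor_sub_pow_le hn hc hy hyY hYM hM hclose ℓ

end SeriesComparison

section SmallAngles

theorem exists_abs_rpow_sub_one_le (a : ℝ) :
    ∃ C : ℝ, 0 ≤ C ∧ ∀ t ∈ Set.Icc (1 / 2 : ℝ) 1, |t ^ a - 1| ≤ C * (1 - t) := by
  have hpos : ∀ t ∈ Set.Icc (1 / 2 : ℝ) 1, t ≠ 0 := fun t ht => by linarith [ht.1]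
  obtain ⟨C, hC⟩ := (isCompact_Icc (a := (1 / 2 : ℝ)) (b := 1)).exists_bound_of_continuousOn
    (f := fun t : ℝ => a * t ^ (a - 1))
    (continuousOn_const.mul (continuousOn_id.rpow_const fun t ht => Or.inl (hpos t ht)))
  have h1 : (1 : ℝ) ∈ Set.Icc (1 / 2 : ℝ) 1 := by norm_num
  refine ⟨C, (norm_nonneg _).trans (hC 1 h1), fun t ht => ?_⟩
  have h := Convex.norm_image_sub_le_of_norm_hasDerivWithin_le
    (f := fun t : ℝ => t ^ a) (f' := fun t : ℝ => a * t ^ (a - 1))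
    (fun t ht => (Real.hasDerivAt_rpow_const (Or.inl (hpos t ht))).hasDerivWithinAt)
    hC (convex_Icc _ _) h1 ht
  simpa [abs_sub_comm t 1, abs_of_nonneg (sub_nonneg.2 ht.2)] using h

theorem exists_abs_prefactor_sub_one_le (α β : ℝ) :
    ∃ C : ℝ, 0 ≤ C ∧ ∀ θ ∈ Set.Ioc (0 : ℝ) 1,
      |(Real.sin (θ / 2) / (θ / 2)) ^ α * Real.cos (θ / 2) ^ β * Real.sqrt (Real.sin θ / θ) - 1| ≤
        C * θ ^ 2 := by
  obtain ⟨C₁, hC₁, h₁⟩ := exists_abs_rpow_sub_one_le α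
  obtain ⟨C₂, hC₂, h₂⟩ := exists_abs_rpow_sub_one_le β
  obtain ⟨C₃, hC₃, h₃⟩ := exists_abs_rpow_sub_one_le (1 / 2)
  have hsinc : ∀ u ∈ Set.Ioc (0 : ℝ) 1, Real.sin u / u ∈ Set.Icc (1 / 2 : ℝ) 1 ∧
      1 - Real.sin u / u ≤ u ^ 2 := by
    intro u hu
    have hlow : 1 - u ^ 2 / 6 ≤ Real.sin u / u := by
      rw [le_div_iff₀ hu.1]
      linarith [Real.sin_gt_sub_cube hu.1]
    have hu2 : u ^ 2 ≤ 1 := pow_le_one₀ hu.1.le hu.2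
    refine ⟨⟨by linarith, ?_⟩, by linarith [sq_nonneg u]⟩
    rw [div_le_one hu.1]
    exact Real.sin_le hu.1.le
  refine ⟨C₁ * (1 + C₂) * (1 + C₃) + C₂ * (1 + C₃) + C₃, by positivity, fun θ hθ => ?_⟩
  have hθ2 : θ ^ 2 ≤ 1 := pow_le_one₀ hθ.1.le hθ.2
  obtain ⟨hs, hs'⟩ := hsinc (θ / 2) ⟨by linarith [hθ.1], by linarith [hθ.1, hθ.2]⟩
  obtain ⟨hr, hr'⟩ := hsinc θ hθ
  have hcos := Real.one_sub_sq_div_two_le_cos (x := θ / 2)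
  have hf : |(Real.sin (θ / 2) / (θ / 2)) ^ α - 1| ≤ C₁ * θ ^ 2 :=
    (h₁ _ hs).trans (by gcongr; nlinarith)
  have hg : |Real.cos (θ / 2) ^ β - 1| ≤ C₂ * θ ^ 2 :=
    (h₂ _ ⟨by nlinarith, Real.cos_le_one _⟩).trans (by gcongr; nlinarith)
  have hh : |Real.sqrt (Real.sin θ / θ) - 1| ≤ C₃ * θ ^ 2 := by
    rw [Real.sqrt_eq_rpow]
    exact (h₃ _ hr).trans (by gcongr)
  set f := (Real.sin (θ / 2) / (θ / 2)) ^ α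
  set g := Real.cos (θ / 2) ^ β
  set h := Real.sqrt (Real.sin θ / θ)
  have hg' : |g| ≤ 1 + C₂ := by
    have := abs_add_le (g - 1) 1
    rw [sub_add_cancel, abs_one] at this
    nlinarith
  have hh' : |h| ≤ 1 + C₃ := by
    have := abs_add_le (h - 1) 1
    rw [sub_add_cancel, abs_one] at this
    nlinarith
  calc |f * g * h - 1| = |(f - 1) * g * h + (g - 1) * h + (h - 1)| := by ring_nf
    _ ≤ |f - 1| * |g| * |h| + |g - 1| * |h| + |h - 1| := by
      rw [← abs_mul, ← abs_mul, ← abs_mul]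
      exact abs_add_three _ _ _
    _ ≤ C₁ * θ ^ 2 * (1 + C₂) * (1 + C₃) + C₂ * θ ^ 2 * (1 + C₃) + C₃ * θ ^ 2 := by gcongr
    _ = (C₁ * (1 + C₂) * (1 + C₃) + C₂ * (1 + C₃) + C₃) * θ ^ 2 := by ring

theorem abs_first_correction_le (a b : ℝ) {θ : ℝ} (hθ : θ ∈ Set.Ioc (0 : ℝ) 1) :
    |(a * (Real.sin θ - θ * Real.cos θ) + 2 * θ * b * (Real.cos θ - 1)) /
      (8 * θ * Real.sin θ)| ≤ (|a| + |b|) * θ := by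
  obtain ⟨h0, h1⟩ := hθ
  have hsin := Real.sin_gt_sub_cube h0
  have hsin' := Real.sin_le h0.le
  have hcos := Real.one_sub_sq_div_two_le_cos (x := θ)
  have hcos' := Real.cos_le_one θ
  have hθ3 : θ ^ 3 ≤ θ := by nlinarith
  have hθ30 : 0 < θ ^ 3 := by positivity
  have hcosθ : θ * (1 - θ ^ 2 / 2) ≤ θ * Real.cos θ := by gcongr
  have hcosθ' : θ * Real.cos θ ≤ θ * 1 := by gcongr
  have hA : |Real.sin θ - θ * Real.cos θ| ≤ θ ^ 3 := by
    rw [abs_le]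
    constructor <;> linarith
  have hB : |2 * θ * (Real.cos θ - 1)| ≤ θ ^ 3 := by
    rw [abs_le]
    constructor <;> linarith
  have hden : θ ^ 2 ≤ 8 * θ * Real.sin θ := by nlinarith
  rw [abs_div, abs_of_pos (lt_of_lt_of_le (by positivity) hden), div_le_iff₀
    (lt_of_lt_of_le (by positivity) hden)]
  calc |a * (Real.sin θ - θ * Real.cos θ) + 2 * θ * b * (Real.cos θ - 1)|
      ≤ |a * (Real.sin θ - θ * Real.cos θ)| + |b * (2 * θ * (Real.cos θ - 1))| := by
        rw [show 2 * θ * b * (Real.cos θ - 1) = b * (2 * θ * (Real.cos θ - 1)) by ring]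
        exact abs_add_le _ _
    _ ≤ |a| * θ ^ 3 + |b| * θ ^ 3 := by
        rw [abs_mul, abs_mul]
        gcongr
    _ = (|a| + |b|) * θ * θ ^ 2 := by ring
    _ ≤ (|a| + |b|) * θ * (8 * θ * Real.sin θ) := by gcongr

theorem sq_sub_sin_sq_le {u : ℝ} (hu : 0 < u) (hu1 : u ≤ 1) :
    u ^ 2 - Real.sin u ^ 2 ≤ u ^ 4 := by
  have h1 := Real.sin_gt_sub_cube hu
  have h2 := Real.sin_le hu.le
  have h3 : 0 ≤ Real.sin u := Real.sin_nonneg_of_nonneg_of_le_pi hu.le (by linarith [Real.pi_gt_three])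
  have h4 : (u - Real.sin u) * (u + Real.sin u) ≤ (u ^ 3 / 6) * (2 * u) := by
    gcongr <;> linarith
  nlinarith [pow_pos hu 4]

end SmallAngles

theorem jacobi_bessel_type_expansion (α β : ℝ) (hα : -1 < α) (hβ : -1 < β)
    (T : ℝ) (hT : 0 < T) :
    ∃ C > (0 : ℝ), ∃ N : ℕ, ∀ n : ℕ, N ≤ n →
      let κ := (n : ℝ) + (α + β + 1) / 2
      let G := Real.Gamma ((n : ℝ) + α + 1) / ((Nat.factorial n : ℝ) * κ ^ α)
      ∀ θ ∈ Set.Ioc 0 (T / κ),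
        let A₁ := ((4 * α ^ 2 - 1) * (Real.sin θ - θ * Real.cos θ) +
          2 * θ * (α ^ 2 - β ^ 2) * (Real.cos θ - 1)) / (8 * θ * Real.sin θ)
        |(Real.sin (θ / 2)) ^ α * (Real.cos (θ / 2)) ^ β *
            Real.sqrt (Real.sin θ / θ) * jacobiP α β n (Real.cos θ) -
            G * (besselJ α (κ * θ) + A₁ * besselJ (α + 1) (κ * θ) / κ)| ≤
          C / κ ^ 2 := by
  obtain ⟨C₁, hC₁, hpre⟩ := exists_abs_prefactor_sub_one_le α β
  set c := (α + β + 1) / 2 with hc_def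
  have hc : -1 < 2 * c := by rw [hc_def]; linarith
  set M := 1 + (T / 2) ^ 2 with hM_def
  have hM : 1 ≤ M := by rw [hM_def]; linarith [sq_nonneg (T / 2)]
  have hα1 : -1 < α + 1 := by linarith
  have htsum_nonneg : ∀ ν : ℝ, -1 < ν → ∀ r : ℝ, 0 ≤ r → 0 ≤ ∑' m, besselCoeff ν m * r ^ m :=
    fun ν hν r hr => tsum_nonneg fun m => mul_nonneg (besselCoeff_pos hν m).le (pow_nonneg hr m)
  set S := ∑' m, besselCoeff α m * M ^ m
  set S₈ := ∑' m, besselCoeff α m * (8 * M) ^ m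
  set S' := ∑' m, besselCoeff (α + 1) m * M ^ m
  have hS : 0 ≤ S := htsum_nonneg α hα M (by positivity)
  have hS₈ : 0 ≤ S₈ := htsum_nonneg α hα (8 * M) (by positivity)
  have hS' : 0 ≤ S' := htsum_nonneg (α + 1) hα1 M (by positivity)
  set D := |4 * α ^ 2 - 1| + |α ^ 2 - β ^ 2|
  have hD : 0 ≤ D := by positivity
  set E₁ := 4 * C₁ * S + ((1 + |c|) ^ 2 + 1) * S₈ with hE₁_def
  have hE₁ : 0 ≤ E₁ := by positivity
  have hGev := (tendsto_Gamma_div_factorial_mul_rpow hα c).eventually_le_const one_lt_two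
  have hκev : ∀ᶠ n : ℕ in atTop, T + 1 - c ≤ (n : ℝ) :=
    tendsto_natCast_atTop_atTop.eventually_ge_atTop _
  obtain ⟨N, hN⟩ := eventually_atTop.1 (hGev.and (hκev.and (eventually_ge_atTop 1)))
  refine ⟨2 * (E₁ * (T / 2) ^ (α + 2) + D * T * ((T / 2) ^ (α + 1) * S')) + 1, by positivity, N,
    fun n hn => ?_⟩
  obtain ⟨hG2, hκT, hn1⟩ := hN n hn
  intro κ G θ hθ A₁
  have hκ_def : κ = (n : ℝ) + c := rfl
  have hκ1 : T + 1 ≤ κ := by rw [hκ_def]; linarith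
  have hκ : 0 < κ := by linarith
  have hθ0 : 0 < θ := hθ.1
  have hθ1 : θ ≤ 1 := hθ.2.trans ((div_le_one hκ).2 (by linarith))
  have hx : 0 < κ * θ := by positivity
  have hxT : κ * θ ≤ T := by
    have := (le_div_iff₀ hκ).1 hθ.2
    linarith
  have hG0 : 0 ≤ G := by
    have hn1' : (1 : ℝ) ≤ n := by exact_mod_cast hn1
    have := Real.Gamma_pos_of_pos (show 0 < (n : ℝ) + α + 1 by linarith)
    positivity
  have hG : G ≤ 2 := hG2
  set Y := (κ * θ / 2) ^ 2 with hY_def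
  set y := κ ^ 2 * ((1 - Real.cos θ) / 2) with hy_def
  have hy_sin : y = κ ^ 2 * Real.sin (θ / 2) ^ 2 := by
    rw [hy_def, Real.sin_sq_eq_half_sub, show 2 * (θ / 2) = θ by ring]
    ring
  have hsin_pos : 0 < Real.sin (θ / 2) :=
    Real.sin_pos_of_pos_of_lt_pi (by linarith) (by linarith [Real.pi_gt_three])
  have hy : 0 ≤ y := by rw [hy_sin]; positivity
  have hY_eq : Y = κ ^ 2 * (θ / 2) ^ 2 := by rw [hY_def]; ring
  have hyY : y ≤ Y := by
    rw [hy_sin, hY_eq]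
    gcongr
    exact Real.sin_le (by linarith)
  have hYM : Y ≤ M := by
    have : Y ≤ (T / 2) ^ 2 := by rw [hY_def]; gcongr
    rw [hM_def]; linarith
  have hY : 0 ≤ Y := hy.trans hyY
  have hclose : Y - y ≤ M * Y / κ ^ 2 := by
    rw [le_div_iff₀ (by positivity)]
    calc (Y - y) * κ ^ 2 = κ ^ 4 * ((θ / 2) ^ 2 - Real.sin (θ / 2) ^ 2) := by
          rw [hY_eq, hy_sin]; ring
      _ ≤ κ ^ 4 * (θ / 2) ^ 4 := by
          gcongr
          exact sq_sub_sin_sq_le (by linarith) (by linarith)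
      _ = Y * Y := by rw [hY_eq]; ring
      _ ≤ M * Y := by gcongr
  set s₁ := ∑ ℓ ∈ Finset.range (n + 1), besselCoeff α ℓ * ((-1) ^ ℓ *
    (y ^ ℓ * dampingFactor c κ ℓ))
  set s₂ := ∑' ℓ : ℕ, besselCoeff α ℓ * ((-1) ^ ℓ * Y ^ ℓ)
  have hs₁ : |s₁| ≤ S := abs_damped_sum_le hα hn1 hc hy (hyY.trans hYM)
  have hs₁₂ : |s₁ - s₂| ≤ Y / κ ^ 2 * ((1 + |c|) ^ 2 + 1) * S₈ :=
    abs_damped_sum_sub_tsum_le hα hn1 hc hy hyY hYM hM hclose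
  have hP : jacobiP α β n (Real.cos θ) = Real.Gamma ((n : ℝ) + α + 1) / (n.factorial : ℝ) * s₁ :=
    jacobiP_eq_Gamma_mul_sum hα hκ.ne' _
  have hJ : besselJ α (κ * θ) = (κ * θ / 2) ^ α * s₂ := besselJ_eq_rpow_mul_tsum α hx
  have hJ' : |besselJ (α + 1) (κ * θ)| ≤ (T / 2) ^ (α + 1) * S' :=
    (abs_besselJ_le hα1 hx hYM).trans (by gcongr; linarith)
  have hA₁ : |A₁| ≤ D * θ := abs_first_correction_le _ _ ⟨hθ0, hθ1⟩
  set F := (Real.sin (θ / 2) / (θ / 2)) ^ α * Real.cos (θ / 2) ^ β *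
    Real.sqrt (Real.sin θ / θ) with hF_def
  have hF : |F - 1| ≤ C₁ * θ ^ 2 := hpre θ ⟨hθ0, hθ1⟩
  have hθκ : θ ^ 2 = 4 * (Y / κ ^ 2) := by
    rw [hY_eq]; field_simp; ring
  have hlead : Real.sin (θ / 2) ^ α * Real.cos (θ / 2) ^ β * Real.sqrt (Real.sin θ / θ) *
      jacobiP α β n (Real.cos θ) = G * ((κ * θ / 2) ^ α * (F * s₁)) := by
    have hκα : κ ^ α ≠ 0 := (Real.rpow_pos_of_pos hκ α).ne'
    have hθα : (θ / 2) ^ α ≠ 0 := (Real.rpow_pos_of_pos (by positivity) α).ne'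
    have hn0 : (n.factorial : ℝ) ≠ 0 := by positivity
    rw [hP, hF_def, Real.div_rpow hsin_pos.le (by positivity), mul_div_assoc κ,
      Real.mul_rpow hκ.le (by positivity)]
    simp only [G]
    field_simp
  have hYT : (κ * θ / 2) ^ α * Y ≤ (T / 2) ^ (α + 2) := by
    rw [hY_def, ← Real.rpow_natCast (κ * θ / 2) 2, ← Real.rpow_add (by positivity)]
    push_cast
    gcongr
    linarith
  have hmain : |(κ * θ / 2) ^ α * (F * s₁ - s₂)| ≤ E₁ * (T / 2) ^ (α + 2) / κ ^ 2 := by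
    rw [abs_mul, abs_of_pos (by positivity : 0 < (κ * θ / 2) ^ α)]
    calc (κ * θ / 2) ^ α * |F * s₁ - s₂|
        ≤ (κ * θ / 2) ^ α * (|F - 1| * |s₁| + |s₁ - s₂|) := by
          rw [← abs_mul, show F * s₁ - s₂ = (F - 1) * s₁ + (s₁ - s₂) by ring]
          gcongr
          exact abs_add_le _ _
      _ ≤ (κ * θ / 2) ^ α * (C₁ * θ ^ 2 * S + Y / κ ^ 2 * ((1 + |c|) ^ 2 + 1) * S₈) := by
          gcongr
      _ = E₁ * ((κ * θ / 2) ^ α * Y) / κ ^ 2 := by rw [hθκ, hE₁_def]; ring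
      _ ≤ E₁ * (T / 2) ^ (α + 2) / κ ^ 2 := by gcongr
  have hcorr : |A₁ * besselJ (α + 1) (κ * θ) / κ| ≤
      D * T * ((T / 2) ^ (α + 1) * S') / κ ^ 2 := by
    rw [abs_div, abs_mul, abs_of_pos hκ]
    calc |A₁| * |besselJ (α + 1) (κ * θ)| / κ
        ≤ D * (T / κ) * ((T / 2) ^ (α + 1) * S') / κ := by
          gcongr
          exact hA₁.trans (by gcongr; exact hθ.2)
      _ = D * T * ((T / 2) ^ (α + 1) * S') / κ ^ 2 := by field_simp
  rw [hlead, hJ]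
  calc |G * ((κ * θ / 2) ^ α * (F * s₁)) -
        G * ((κ * θ / 2) ^ α * s₂ + A₁ * besselJ (α + 1) (κ * θ) / κ)|
      = G * |(κ * θ / 2) ^ α * (F * s₁ - s₂) - A₁ * besselJ (α + 1) (κ * θ) / κ| := by
        rw [← abs_of_nonneg hG0, ← abs_mul, abs_of_nonneg hG0]
        ring_nf
    _ ≤ 2 * (E₁ * (T / 2) ^ (α + 2) / κ ^ 2 + D * T * ((T / 2) ^ (α + 1) * S') / κ ^ 2) := by
        gcongr
        exact (abs_sub _ _).trans (add_le_add hmain hcorr)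
    _ = 2 * (E₁ * (T / 2) ^ (α + 2) + D * T * ((T / 2) ^ (α + 1) * S')) / κ ^ 2 := by ring
    _ ≤ (2 * (E₁ * (T / 2) ^ (α + 2) + D * T * ((T / 2) ^ (α + 1) * S')) + 1) / κ ^ 2 := by
        gcongr
        linarith
end

section
/- Let α, β > −1 be real and let j > 0 satisfy J_α(j) = 0, where J_α(x) = Σ_{m=0}^∞ ((−1)^m/(m! Γ(m+α+1)))(x/2)^{2m+α}. Then there exist constants C > 0 and N ∈ ℕ such that for every n ≥ N there is θ* ∈ (0, π) with P_n^{(α,β)}(cos θ*) = 0 and |θ* − j/κ − A₁(j/κ)/κ²| ≤ C/κ⁴, where κ = n + (α+β+1)/2 and A₁(θ) = ((4α² − 1)(sin θ − θ cos θ) + 2θ(α² − β²)(cos θ − 1))/(8θ sin θ). -/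
open Real

/-- The `ℓ`-th term `w ^ ℓ / ((a)_ℓ ℓ!)` of the confluent hypergeometric series `₀F₁(; a; w)`. -/
noncomputable def hypTerm (a w : ℝ) (ℓ : ℕ) : ℝ :=
  w ^ ℓ / ((ascPochhammer ℝ ℓ).eval a * (Nat.factorial ℓ : ℝ))

/-- The confluent hypergeometric limit function `₀F₁(; a; w)`. -/
noncomputable def hyp (a w : ℝ) : ℝ := ∑' ℓ, hypTerm a w ℓ

theorem min_one_le_ascPochhammer_eval {a : ℝ} (ha : 0 < a) (ℓ : ℕ) :
    min 1 a ≤ (ascPochhammer ℝ ℓ).eval a := by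
  induction ℓ with
  | zero => simp
  | succ k ih =>
    rw [ascPochhammer_succ_eval]
    rcases Nat.eq_zero_or_pos k with rfl | hk
    · simp
    · have h1 : (1 : ℝ) ≤ k := by exact_mod_cast hk
      have h0 := ascPochhammer_pos k a ha
      nlinarith

theorem le_ascPochhammer_succ_eval {a : ℝ} (ha : 1 ≤ a) (ℓ : ℕ) :
    a ≤ (ascPochhammer ℝ (ℓ + 1)).eval a := by
  induction ℓ with
  | zero => simp
  | succ k ih =>
    rw [ascPochhammer_succ_eval]
    have h1 : (0 : ℝ) ≤ (k + 1 : ℕ) := by positivity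
    nlinarith

theorem ascPochhammer_succ_eval_left (a : ℝ) (ℓ : ℕ) :
    (ascPochhammer ℝ (ℓ + 1)).eval a = a * (ascPochhammer ℝ ℓ).eval (a + 1) := by
  simp [ascPochhammer_succ_left]

theorem abs_hypTerm {a : ℝ} (ha : 0 < a) (w : ℝ) (ℓ : ℕ) :
    |hypTerm a w ℓ| = hypTerm a |w| ℓ := by
  have h0 := ascPochhammer_pos ℓ a ha
  rw [hypTerm, hypTerm, abs_div, abs_pow, abs_of_pos (a := _ * _) (by positivity)]

theorem hypTerm_mono {a : ℝ} (ha : 0 < a) {w R : ℝ} (hw : 0 ≤ w) (hR : w ≤ R) (ℓ : ℕ) :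
    hypTerm a w ℓ ≤ hypTerm a R ℓ := by
  have h0 := ascPochhammer_pos ℓ a ha
  unfold hypTerm
  gcongr

theorem hypTerm_nonneg {a : ℝ} (ha : 0 < a) {w : ℝ} (hw : 0 ≤ w) (ℓ : ℕ) :
    0 ≤ hypTerm a w ℓ := by
  have h0 := ascPochhammer_pos ℓ a ha
  unfold hypTerm
  positivity

theorem summable_pow_mul_hypTerm_of_nonneg {a : ℝ} (ha : 0 < a) {R r : ℝ} (hR : 0 ≤ R)
    (hr : 0 ≤ r) (k : ℕ) : Summable fun ℓ : ℕ => ((ℓ : ℝ) + r) ^ k * hypTerm a R ℓ := by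
  have hm : 0 < min 1 a := lt_min one_pos ha
  have hs : Summable fun ℓ : ℕ => (k.factorial * Real.exp r / min 1 a) *
      ((Real.exp 1 * R) ^ ℓ / (ℓ.factorial : ℝ)) :=
    (Real.summable_pow_div_factorial (Real.exp 1 * R)).mul_left _
  refine Summable.of_nonneg_of_le (fun ℓ => mul_nonneg (by positivity) (hypTerm_nonneg ha hR ℓ))
    (fun ℓ => ?_) hs
  have h1 : ((ℓ : ℝ) + r) ^ k ≤ k.factorial * (Real.exp 1 ^ ℓ * Real.exp r) := by
    have h := Real.pow_div_factorial_le_exp (x := (ℓ : ℝ) + r) (by positivity) k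
    rw [div_le_iff₀ (by positivity), Real.exp_add, ← Real.exp_one_pow] at h
    linarith
  have h2 : hypTerm a R ℓ ≤ R ^ ℓ / (min 1 a * ℓ.factorial) := by
    unfold hypTerm
    have := min_one_le_ascPochhammer_eval ha ℓ
    gcongr
  calc ((ℓ : ℝ) + r) ^ k * hypTerm a R ℓ
      ≤ (k.factorial * (Real.exp 1 ^ ℓ * Real.exp r)) * (R ^ ℓ / (min 1 a * ℓ.factorial)) :=
        mul_le_mul h1 h2 (hypTerm_nonneg ha hR ℓ) (by positivity)
    _ = _ := by rw [mul_pow]; field_simp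

theorem summable_hypTerm {a : ℝ} (ha : 0 < a) (w : ℝ) : Summable (hypTerm a w) := by
  have h := summable_pow_mul_hypTerm_of_nonneg ha (abs_nonneg w) le_rfl 0
  refine Summable.of_norm ?_
  simpa [Real.norm_eq_abs, abs_hypTerm ha] using h

theorem succ_mul_hypTerm_succ {a : ℝ} (ha : 0 < a) (w : ℝ) (ℓ : ℕ) :
    ((ℓ : ℝ) + 1) * hypTerm a w (ℓ + 1) = w / a * hypTerm (a + 1) w ℓ := by
  have h0 := ascPochhammer_pos ℓ (a + 1) (by linarith)
  rw [hypTerm, hypTerm, ascPochhammer_succ_eval_left, Nat.factorial_succ]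
  push_cast
  field_simp
  ring

theorem hasDerivAt_hyp {a : ℝ} (ha : 0 < a) (w : ℝ) :
    HasDerivAt (hyp a) (1 / a * hyp (a + 1) w) w := by
  have ha' : 0 < a + 1 := by linarith
  set R := |w| + 1 with hRdef
  have hR : 0 ≤ R := by positivity
  have hu : Summable fun ℓ : ℕ => (1 / a) * hypTerm (a + 1) R ℓ := (summable_hypTerm ha' R).mul_left _
  have hterm : ∀ (ℓ : ℕ) (y : ℝ), y ∈ Metric.ball (0 : ℝ) R →
      HasDerivAt (fun y => hypTerm a y (ℓ + 1)) (1 / a * hypTerm (a + 1) y ℓ) y := by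
    intro ℓ y _
    have h0 := ascPochhammer_pos ℓ (a + 1) ha'
    have h := (hasDerivAt_pow (ℓ + 1) y).div_const
      ((ascPochhammer ℝ (ℓ + 1)).eval a * ((ℓ + 1).factorial : ℝ))
    refine h.congr_deriv ?_
    rw [hypTerm, ascPochhammer_succ_eval_left, Nat.factorial_succ]
    push_cast
    field_simp
  have hsum : ∀ y, Summable fun ℓ => hypTerm a y (ℓ + 1) := fun y =>
    (summable_nat_add_iff 1).2 (summable_hypTerm ha y)
  have hd := hasDerivAt_tsum_of_isPreconnected (y := w) (y₀ := 0) hu Metric.isOpen_ball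
    (convex_ball (0 : ℝ) R).isPreconnected hterm (fun ℓ y hy => by
      rw [Real.norm_eq_abs, abs_mul, abs_hypTerm ha', abs_of_pos (by positivity)]
      have hy' : |y| ≤ R := by simpa using (mem_ball_zero_iff.1 hy).le
      exact mul_le_mul_of_nonneg_left (hypTerm_mono ha' (abs_nonneg y) hy' ℓ) (by positivity))
    (by simp; positivity) (hsum 0) (by simp [hRdef])
  have heq : hyp a = fun z => 1 + ∑' ℓ, hypTerm a z (ℓ + 1) := by
    funext z
    rw [hyp, (summable_hypTerm ha z).tsum_eq_zero_add]
    simp [hypTerm]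
  rw [heq, hyp, ← tsum_mul_left]
  exact hd.const_add 1

/-- Contiguous relation for `₀F₁`. -/
theorem hyp_sub_hyp_succ {a : ℝ} (ha : 0 < a) (w : ℝ) :
    hyp a w - hyp (a + 1) w = w / (a * (a + 1)) * hyp (a + 2) w := by
  have s0 := summable_hypTerm ha w
  have s1 := summable_hypTerm (a := a + 1) (by linarith) w
  rw [hyp, hyp, hyp, s0.tsum_eq_zero_add, s1.tsum_eq_zero_add, ← tsum_mul_left,
    add_sub_add_comm, ← ((summable_nat_add_iff 1).2 s0).tsum_sub ((summable_nat_add_iff 1).2 s1)]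
  have : hypTerm a w 0 - hypTerm (a + 1) w 0 = 0 := by simp [hypTerm]
  rw [this, zero_add]
  congr 1
  funext ℓ
  have h2 : a + 2 = a + 1 + 1 := by ring
  have h0 := ascPochhammer_pos ℓ (a + 1 + 1) (by linarith)
  have h1 := ascPochhammer_pos ℓ (a + 1) (by linarith)
  have key : (ascPochhammer ℝ ℓ).eval (a + 1) * (a + 1 + ℓ) =
      (a + 1) * (ascPochhammer ℝ ℓ).eval (a + 1 + 1) := by
    rw [← ascPochhammer_succ_eval, ascPochhammer_succ_eval_left]
  have hl : (0 : ℝ) < a + 1 + ℓ := by positivity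
  have h3 : (ascPochhammer ℝ ℓ).eval (a + 1) =
      (a + 1) * (ascPochhammer ℝ ℓ).eval (a + 1 + 1) / (a + 1 + ℓ) := by
    rw [← key]; field_simp
  rw [hypTerm, hypTerm, hypTerm, ascPochhammer_succ_eval_left, ascPochhammer_succ_eval_left,
    Nat.factorial_succ, h2, h3]
  push_cast
  field_simp
  ring

theorem abs_hyp_sub_one_le {b : ℝ} (hb : 1 ≤ b) (w : ℝ) : |hyp b w - 1| ≤ Real.exp |w| / b * |w| := by
  have hb0 : 0 < b := by linarith
  have s0 := summable_hypTerm hb0 w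
  have h1 : hyp b w - 1 = ∑' ℓ, hypTerm b w (ℓ + 1) := by
    rw [hyp, s0.tsum_eq_zero_add]; simp [hypTerm]
  have hs : HasSum (fun ℓ : ℕ => |w| / b * (|w| ^ ℓ / (ℓ.factorial : ℝ))) (|w| / b * Real.exp |w|) := by
    rw [Real.exp_eq_exp_ℝ]
    exact (NormedSpace.expSeries_div_hasSum_exp |w|).mul_left _
  rw [h1, ← Real.norm_eq_abs]
  have := tsum_of_norm_bounded hs (f := fun ℓ => hypTerm b w (ℓ + 1)) (fun ℓ => by
    rw [Real.norm_eq_abs, abs_hypTerm hb0, hypTerm, pow_succ, Nat.factorial_succ]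
    have h2 := le_ascPochhammer_succ_eval hb ℓ
    calc _ ≤ |w| ^ ℓ * |w| / (b * ((1 * ℓ.factorial : ℕ) : ℝ)) := by
          have h3 : 1 ≤ ℓ + 1 := Nat.le_add_left 1 ℓ
          have h4 := ascPochhammer_pos (ℓ + 1) b hb0
          gcongr
      _ = _ := by push_cast; field_simp)
  calc _ ≤ _ := this
    _ = _ := by ring

/-- `₀F₁(; a; ·)` and `₀F₁(; a + 1; ·)` have no common nonzero root. -/
theorem hyp_succ_ne_zero {a : ℝ} (ha : 0 < a) {w : ℝ} (hw : w ≠ 0) (h : hyp a w = 0) :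
    hyp (a + 1) w ≠ 0 := by
  intro h'
  have hall : ∀ k : ℕ, hyp (a + k) w = 0 ∧ hyp (a + k + 1) w = 0 := by
    intro k
    induction k with
    | zero => simpa using ⟨h, h'⟩
    | succ k ih =>
      have hk : 0 < a + k := by positivity
      have hc := hyp_sub_hyp_succ hk w
      rw [ih.1, ih.2, sub_zero, eq_comm, mul_eq_zero] at hc
      have h2 : hyp (a + k + 2) w = 0 := hc.resolve_left (by positivity)
      push_cast
      refine ⟨by rw [← add_assoc]; exact ih.2, ?_⟩
      rw [show a + (k + 1) + 1 = a + k + 2 by ring]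
      exact h2
  obtain ⟨k, hk⟩ := exists_nat_gt (Real.exp |w| * |w| + 1)
  have hk1 : 1 ≤ a + k := by
    have : 0 ≤ Real.exp |w| * |w| := by positivity
    linarith
  have hb := abs_hyp_sub_one_le hk1 w
  rw [(hall k).1, zero_sub, abs_neg, abs_one, div_mul_eq_mul_div, le_div_iff₀ (by linarith)] at hb
  linarith

theorem hasSum_mul_hypTerm_of_succ {a w s : ℝ} (ha : 0 < a) {p q : ℕ → ℝ} (hq0 : q 0 = 0)
    (hq : ∀ ℓ : ℕ, q (ℓ + 1) = (ℓ + 1) * p ℓ)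
    (h : HasSum (fun ℓ => p ℓ * hypTerm (a + 1) w ℓ) s) :
    HasSum (fun ℓ => q ℓ * hypTerm a w ℓ) (w / a * s) := by
  rw [← hasSum_nat_add_iff' 1]
  simp only [Finset.range_one, Finset.sum_singleton, hq0, zero_mul, sub_zero]
  refine (h.mul_left (w / a)).congr_fun fun ℓ => ?_
  rw [hq]
  linear_combination p ℓ * succ_mul_hypTerm_succ ha w ℓ

/-- The sum `∑ (∑ i < ℓ, (i + ρ) ^ 2) w ^ ℓ / ((a)_ℓ ℓ!)` in closed form. -/
noncomputable def hypCorrection (a ρ w : ℝ) : ℝ :=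
  w ^ 3 / (3 * (a * (a + 1) * (a + 2))) * hyp (a + 3) w +
    (1 / 2 + ρ) * (w ^ 2 / (a * (a + 1)) * hyp (a + 2) w) + ρ ^ 2 * (w / a * hyp (a + 1) w)

theorem sum_range_add_sq (ρ : ℝ) (ℓ : ℕ) : ∑ i ∈ Finset.range ℓ, ((i : ℝ) + ρ) ^ 2 =
    ℓ * ((ℓ - 1) * (ℓ - 1 - 1)) / 3 + (1 / 2 + ρ) * (ℓ * (ℓ - 1)) + ρ ^ 2 * ℓ := by
  induction ℓ with
  | zero => simp
  | succ k ih => rw [Finset.sum_range_succ, ih]; push_cast; ring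

theorem hasSum_hypCorrection {a : ℝ} (ha : 0 < a) (ρ w : ℝ) :
    HasSum (fun ℓ => (∑ i ∈ Finset.range ℓ, ((i : ℝ) + ρ) ^ 2) * hypTerm a w ℓ)
      (hypCorrection a ρ w) := by
  have one : ∀ b : ℝ, 0 < b →
      HasSum (fun ℓ : ℕ => (ℓ : ℝ) * hypTerm b w ℓ) (w / b * hyp (b + 1) w) := by
    intro b hb
    refine hasSum_mul_hypTerm_of_succ (p := fun _ => 1) hb (by simp) (fun ℓ => by push_cast; ring) ?_
    simp only [one_mul]
    exact (summable_hypTerm (by linarith) w).hasSum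
  have two : ∀ b : ℝ, 0 < b → HasSum (fun ℓ : ℕ => ((ℓ : ℝ) * (ℓ - 1)) * hypTerm b w ℓ)
      (w / b * (w / (b + 1) * hyp (b + 1 + 1) w)) := fun b hb =>
    hasSum_mul_hypTerm_of_succ hb (by simp) (fun ℓ => by push_cast; ring) (one (b + 1) (by linarith))
  have three : HasSum (fun ℓ : ℕ => ((ℓ : ℝ) * ((ℓ - 1) * (ℓ - 1 - 1))) * hypTerm a w ℓ)
      (w / a * (w / (a + 1) * (w / (a + 1 + 1) * hyp (a + 1 + 1 + 1) w))) :=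
    hasSum_mul_hypTerm_of_succ ha (by simp) (fun ℓ => by push_cast; ring) (two (a + 1) (by linarith))
  have h := ((three.mul_left (1 / 3)).add ((two a ha).mul_left (1 / 2 + ρ))).add
    ((one a ha).mul_left (ρ ^ 2))
  have hval : hypCorrection a ρ w = 1 / 3 * (w / a * (w / (a + 1) * (w / (a + 1 + 1) *
      hyp (a + 1 + 1 + 1) w))) + (1 / 2 + ρ) * (w / a * (w / (a + 1) * hyp (a + 1 + 1) w)) +
      ρ ^ 2 * (w / a * hyp (a + 1) w) := by
    rw [hypCorrection, show a + 1 + 1 + 1 = a + 3 by ring, show a + 1 + 1 = a + 2 by ring]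
    field_simp
  rw [hval]
  refine h.congr_fun fun ℓ => ?_
  rw [sum_range_add_sq]
  ring

theorem differentiable_hypCorrection {a : ℝ} (ha : 0 < a) (ρ : ℝ) :
    Differentiable ℝ (hypCorrection a ρ) := by
  have h : ∀ b : ℝ, 0 < b → Differentiable ℝ (hyp b) := fun b hb w =>
    (hasDerivAt_hyp hb w).differentiableAt
  have h1 := h (a + 1) (by linarith)
  have h2 := h (a + 2) (by linarith)
  have h3 := h (a + 3) (by linarith)
  unfold hypCorrection
  fun_prop

theorem hypCorrection_of_hyp_eq_zero {a : ℝ} (ha : 0 < a) (ρ : ℝ) {w : ℝ} (h : hyp a w = 0) :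
    hypCorrection a ρ w =
      1 / a * hyp (a + 1) w * (w * ((w + a * (a + 1)) / 3 - (1 / 2 + ρ) * a + ρ ^ 2)) := by
  have e1 := hyp_sub_hyp_succ ha w
  have e2 := hyp_sub_hyp_succ (a := a + 1) (by linarith) w
  rw [show a + 1 + 1 = a + 2 by ring, show a + 1 + 2 = a + 3 by ring] at e2
  rw [h, zero_sub] at e1
  have h1 : hyp (a + 1) w = -(w / (a * (a + 1)) * hyp (a + 2) w) := by linarith
  have h3 : w ^ 3 / (3 * (a * (a + 1) * (a + 2))) * hyp (a + 3) w =
      w ^ 2 / (3 * a) * (hyp (a + 1) w - hyp (a + 2) w) := by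
    rw [e2]; field_simp
  rw [hypCorrection, h3, h1]
  field_simp
  ring

theorem abs_prod_one_sub_sub_le (x : ℕ → ℝ) (ℓ : ℕ) (hx : ∀ i < ℓ, 0 ≤ x i ∧ x i ≤ 1) :
    |∏ i ∈ Finset.range ℓ, (1 - x i) - (1 - ∑ i ∈ Finset.range ℓ, x i)| ≤
      (∑ i ∈ Finset.range ℓ, x i) ^ 2 := by
  have key : 0 ≤ ∏ i ∈ Finset.range ℓ, (1 - x i) ∧ ∏ i ∈ Finset.range ℓ, (1 - x i) ≤ 1 ∧
      0 ≤ ∑ i ∈ Finset.range ℓ, x i ∧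
      1 - ∑ i ∈ Finset.range ℓ, x i ≤ ∏ i ∈ Finset.range ℓ, (1 - x i) ∧
      ∏ i ∈ Finset.range ℓ, (1 - x i) ≤
        1 - ∑ i ∈ Finset.range ℓ, x i + (∑ i ∈ Finset.range ℓ, x i) ^ 2 := by
    induction ℓ with
    | zero => simp
    | succ k ih =>
      obtain ⟨h0, h1, h2, h3, h4⟩ := ih fun i hi => hx i (by omega)
      obtain ⟨hx0, hx1⟩ := hx k (by omega)
      rw [Finset.prod_range_succ, Finset.sum_range_succ]
      set P := ∏ i ∈ Finset.range k, (1 - x i)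
      set S := ∑ i ∈ Finset.range k, x i
      have hPx : P * x k ≤ 1 * x k := mul_le_mul_of_nonneg_right h1 hx0
      have hPx0 : 0 ≤ P * x k := mul_nonneg h0 hx0
      have hm := mul_le_mul_of_nonneg_right h4 (by linarith : 0 ≤ 1 - x k)
      refine ⟨mul_nonneg h0 (by linarith), by linarith, by linarith, by linarith, ?_⟩
      nlinarith [mul_nonneg h2 hx0, mul_nonneg (sq_nonneg S) hx0, sq_nonneg (x k)]
  rw [abs_of_nonneg (by linarith [key.2.2.2.1])]
  linarith [key.2.2.2.2]

theorem jacobiP_eq_sum_hypTerm {α : ℝ} (β : ℝ) (hα : -1 < α) (n : ℕ) (x : ℝ) {κ : ℝ}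
    (hκ : κ = n + (α + β + 1) / 2) (hκ0 : κ ≠ 0) :
    jacobiP α β n x = (ascPochhammer ℝ n).eval (α + 1) / n.factorial *
      ∑ ℓ ∈ Finset.range (n + 1),
        (∏ i ∈ Finset.range ℓ, (1 - ((i : ℝ) + (α + β + 1) / 2) ^ 2 / κ ^ 2)) *
          hypTerm (α + 1) (κ ^ 2 * ((x - 1) / 2)) ℓ := by
  have ha : 0 < α + 1 := by linarith
  rw [jacobiP, Finset.mul_sum]
  refine Finset.sum_congr rfl fun ℓ hℓ => ?_
  have hℓn : ℓ ≤ n := Nat.lt_succ_iff.1 (Finset.mem_range.1 hℓ)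
  have hp0 := ascPochhammer_pos ℓ (α + 1) ha
  have hsplit : (ascPochhammer ℝ n).eval (α + 1) =
      (ascPochhammer ℝ ℓ).eval (α + 1) * (ascPochhammer ℝ (n - ℓ)).eval (α + ℓ + 1) := by
    conv_lhs => rw [← Nat.add_sub_cancel' hℓn, ← ascPochhammer_mul]
    simp only [Polynomial.eval_mul, Polynomial.eval_comp, Polynomial.eval_add, Polynomial.eval_X,
      Polynomial.eval_natCast]
    rw [add_right_comm]
  have hprod : ∀ m : ℕ, m ≤ n →
      (∏ i ∈ Finset.range m, (1 - ((i : ℝ) + (α + β + 1) / 2) ^ 2 / κ ^ 2)) * (κ ^ 2) ^ m *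
        (n - m).factorial =
      (ascPochhammer ℝ m).eval ((n : ℝ) + α + β + 1) * n.factorial := by
    intro m hm
    induction m with
    | zero => simp
    | succ k ih =>
      have hk := ih (by omega)
      have hf : ((n - k).factorial : ℝ) = (n - k) * (n - (k + 1)).factorial := by
        rw [show n - k = (n - (k + 1)) + 1 by omega, Nat.factorial_succ]
        push_cast [Nat.cast_sub hm]
        ring
      rw [hf] at hk
      rw [Finset.prod_range_succ, ascPochhammer_succ_eval, pow_succ (κ ^ 2) k]
      have hfac : (1 - ((k : ℝ) + (α + β + 1) / 2) ^ 2 / κ ^ 2) * κ ^ 2 =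
          (n - k) * (n + α + β + 1 + k) := by
        field_simp
        rw [hκ]; ring
      generalize ∏ i ∈ Finset.range k, (1 - ((i : ℝ) + (α + β + 1) / 2) ^ 2 / κ ^ 2) = Q at hk ⊢
      generalize 1 - ((k : ℝ) + (α + β + 1) / 2) ^ 2 / κ ^ 2 = q at hfac ⊢
      linear_combination (n + α + β + 1 + k : ℝ) * hk +
        Q * (κ ^ 2) ^ k * (n - (k + 1)).factorial * hfac
  have h := hprod ℓ hℓn
  have hfn : (0 : ℝ) < (n - ℓ).factorial := by positivity
  rw [hsplit, hypTerm, mul_pow]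
  rw [← eq_div_iff hfn.ne'] at h
  have hgoal : ∀ P E : ℝ, P * (κ ^ 2) ^ ℓ = E * n.factorial / (n - ℓ).factorial →
      E * (ascPochhammer ℝ (n - ℓ)).eval (α + ℓ + 1) / (ℓ.factorial * (n - ℓ).factorial) *
        ((x - 1) / 2) ^ ℓ =
      (ascPochhammer ℝ ℓ).eval (α + 1) * (ascPochhammer ℝ (n - ℓ)).eval (α + ℓ + 1) /
        n.factorial * (P * ((κ ^ 2) ^ ℓ * ((x - 1) / 2) ^ ℓ /
          ((ascPochhammer ℝ ℓ).eval (α + 1) * ℓ.factorial))) := by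
    intro P E hPE
    have e : P * ((κ ^ 2) ^ ℓ * ((x - 1) / 2) ^ ℓ /
          ((ascPochhammer ℝ ℓ).eval (α + 1) * ℓ.factorial)) =
        (E * n.factorial / (n - ℓ).factorial) * (((x - 1) / 2) ^ ℓ /
          ((ascPochhammer ℝ ℓ).eval (α + 1) * ℓ.factorial)) := by
      rw [← hPE]; ring
    rw [e]
    field_simp
  exact hgoal _ _ h

theorem sum_range_add_sq_le (ρ : ℝ) (ℓ : ℕ) :
    ∑ i ∈ Finset.range ℓ, ((i : ℝ) + ρ) ^ 2 ≤ ((ℓ : ℝ) + |ρ|) ^ 3 := by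
  have hle : ∀ i ∈ Finset.range ℓ, ((i : ℝ) + ρ) ^ 2 ≤ ((ℓ : ℝ) + |ρ|) ^ 2 := by
    intro i hi
    have hi' : (i : ℝ) ≤ ℓ := by exact_mod_cast (Finset.mem_range.1 hi).le
    refine sq_le_sq' ?_ ?_
    · linarith [neg_abs_le ρ, (Nat.cast_nonneg i : (0 : ℝ) ≤ i), (Nat.cast_nonneg ℓ : (0 : ℝ) ≤ ℓ)]
    · linarith [le_abs_self ρ]
  refine (Finset.sum_le_card_nsmul _ _ _ hle).trans ?_
  rw [Finset.card_range, nsmul_eq_mul, pow_succ' _ 2]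
  gcongr
  linarith [abs_nonneg ρ]

/-- Second-order expansion of the hypergeometric sum representing a Jacobi polynomial. -/
theorem exists_abs_sum_prod_mul_hypTerm_sub_le {a : ℝ} (ha : 0 < a) {ρ : ℝ} (hρ : -1 / 2 < ρ)
    (R : ℝ) : ∃ C : ℝ, ∀ (n : ℕ) (w : ℝ), 1 ≤ n → |w| ≤ R →
      |∑ ℓ ∈ Finset.range (n + 1),
        (∏ i ∈ Finset.range ℓ, (1 - ((i : ℝ) + ρ) ^ 2 / ((n : ℝ) + ρ) ^ 2)) * hypTerm a w ℓ -
        (hyp a w - (1 / ((n : ℝ) + ρ)) ^ 2 * hypCorrection a ρ w)| ≤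
      C * (1 / ((n : ℝ) + ρ)) ^ 4 := by
  have hR0 := abs_nonneg R
  have hsum := summable_pow_mul_hypTerm_of_nonneg ha hR0 (abs_nonneg ρ) 6
  refine ⟨∑' ℓ : ℕ, ((ℓ : ℝ) + |ρ|) ^ 6 * hypTerm a |R| ℓ, fun n w hn hw => ?_⟩
  have hn1 : (1 : ℝ) ≤ n := by exact_mod_cast hn
  have hκ : 0 < (n : ℝ) + ρ := by linarith
  set κ := (n : ℝ) + ρ with hκdef
  set P : ℕ → ℝ := fun ℓ => ∏ i ∈ Finset.range ℓ, (1 - ((i : ℝ) + ρ) ^ 2 / κ ^ 2) with hP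
  set S : ℕ → ℝ := fun ℓ => ∑ i ∈ Finset.range ℓ, ((i : ℝ) + ρ) ^ 2 with hS
  have hSx : ∀ ℓ, ∑ i ∈ Finset.range ℓ, ((i : ℝ) + ρ) ^ 2 / κ ^ 2 = (1 / κ) ^ 2 * S ℓ := by
    intro ℓ
    rw [← Finset.sum_div, one_div, inv_pow, div_eq_inv_mul]
  have hP0 : ∀ ℓ, n < ℓ → P ℓ = 0 := by
    intro ℓ hℓ
    refine Finset.prod_eq_zero (Finset.mem_range.2 hℓ) ?_
    rw [← hκdef, div_self (by positivity), sub_self]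
  have hbound : ∀ ℓ, |P ℓ - (1 - (1 / κ) ^ 2 * S ℓ)| ≤ ((1 / κ) ^ 2 * S ℓ) ^ 2 := by
    intro ℓ
    rcases le_or_gt ℓ n with hℓ | hℓ
    · rw [← hSx]
      refine abs_prod_one_sub_sub_le _ ℓ fun i hi => ⟨by positivity, ?_⟩
      rw [div_le_one (by positivity)]
      have hin : (i : ℝ) ≤ n := by exact_mod_cast (by omega : i ≤ n)
      have hi0 : (0 : ℝ) ≤ i := Nat.cast_nonneg i
      exact sq_le_sq' (by linarith) (by linarith)
    · have h1 : 1 ≤ (1 / κ) ^ 2 * S ℓ := by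
        rw [← hSx]
        refine le_trans ?_ (Finset.single_le_sum (f := fun i : ℕ => ((i : ℝ) + ρ) ^ 2 / κ ^ 2)
          (fun i _ => by positivity) (Finset.mem_range.2 hℓ))
        rw [← hκdef, div_self (by positivity)]
      rw [hP0 ℓ hℓ, abs_of_nonneg (by linarith)]
      nlinarith
  have hfin : HasSum (fun ℓ => P ℓ * hypTerm a w ℓ)
      (∑ ℓ ∈ Finset.range (n + 1), P ℓ * hypTerm a w ℓ) := by
    refine hasSum_sum_of_ne_finset_zero fun ℓ hℓ => ?_
    rw [hP0 ℓ (by simpa using hℓ), zero_mul]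
  have hall := hfin.sub ((summable_hypTerm ha w).hasSum.sub
    ((hasSum_hypCorrection ha ρ w).mul_left ((1 / κ) ^ 2)))
  change |_ - (∑' ℓ, hypTerm a w ℓ - _)| ≤ _
  rw [← hall.tsum_eq, ← Real.norm_eq_abs]
  refine tsum_of_norm_bounded (hsum.hasSum.mul_right _) fun ℓ => ?_
  have hS0 : 0 ≤ S ℓ := Finset.sum_nonneg fun i _ => by positivity
  have hS6 : S ℓ ^ 2 ≤ ((ℓ : ℝ) + |ρ|) ^ 6 := by
    rw [show 6 = 3 * 2 by norm_num, pow_mul]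
    exact pow_le_pow_left₀ hS0 (sum_range_add_sq_le ρ ℓ) 2
  have hT : |hypTerm a w ℓ| ≤ hypTerm a |R| ℓ := by
    rw [abs_hypTerm ha]
    exact hypTerm_mono ha (abs_nonneg w) (hw.trans (le_abs_self R)) ℓ
  calc _ = |P ℓ - (1 - (1 / κ) ^ 2 * S ℓ)| * |hypTerm a w ℓ| := by
        rw [Real.norm_eq_abs, ← abs_mul]; congr 1; simp only [hS]; ring
    _ ≤ ((1 / κ) ^ 2 * S ℓ) ^ 2 * hypTerm a |R| ℓ :=
        mul_le_mul (hbound ℓ) hT (abs_nonneg _) (by positivity)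
    _ = S ℓ ^ 2 * hypTerm a |R| ℓ * (1 / κ) ^ 4 := by ring
    _ ≤ _ := by
        have := hypTerm_nonneg ha hR0 ℓ
        gcongr

theorem hyp_eq_zero_of_besselJ_eq_zero {α x : ℝ} (hα : -1 < α) (hx : 0 < x)
    (h : besselJ α x = 0) : hyp (α + 1) (-x ^ 2 / 4) = 0 := by
  have ha : 0 < α + 1 := by linarith
  have hG : ∀ m : ℕ, Real.Gamma ((m : ℝ) + α + 1) =
      (ascPochhammer ℝ m).eval (α + 1) * Real.Gamma (α + 1) := by
    intro m
    induction m with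
    | zero => simp
    | succ k ih =>
      have hk : (0 : ℝ) < k + α + 1 := by
        have : (0 : ℝ) ≤ k := Nat.cast_nonneg k
        linarith
      rw [ascPochhammer_succ_eval, show ((k + 1 : ℕ) : ℝ) + α + 1 = (k + α + 1) + 1 by push_cast; ring,
        Real.Gamma_add_one hk.ne', ih]
      ring
  have hG0 : 0 < Real.Gamma (α + 1) := Real.Gamma_pos_of_pos ha
  have key : besselJ α x = (x / 2) ^ α / Real.Gamma (α + 1) * hyp (α + 1) (-x ^ 2 / 4) := by
    rw [besselJ, hyp, ← tsum_mul_left]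
    congr 1
    funext m
    have hp := ascPochhammer_pos m (α + 1) ha
    rw [Real.rpow_add (by positivity), show (2 * (m : ℝ)) = ((2 * m : ℕ) : ℝ) by push_cast; ring,
      Real.rpow_natCast, hG, hypTerm, show -x ^ 2 / 4 = -1 * (x / 2) ^ 2 by ring, mul_pow, ← pow_mul]
    field_simp
  rw [key, mul_eq_zero] at h
  exact h.resolve_left (by positivity)

open Filter Topology Asymptotics

theorem isBigO_sub_sub_mul_of_hasDerivAt {f f' : ℝ → ℝ} {x₀ : ℝ} (hf : ∀ x, HasDerivAt f (f' x) x)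
    (hf' : DifferentiableAt ℝ f' x₀) :
    (fun x => f x - f x₀ - f' x₀ * (x - x₀)) =O[𝓝 x₀] fun x => (x - x₀) ^ 2 := by
  obtain ⟨C, hC0, hC⟩ := hf'.isBigO_sub.exists_pos
  obtain ⟨δ, hδ, hball⟩ := Metric.eventually_nhds_iff_ball.1 hC.bound
  refine IsBigO.of_bound C ?_
  filter_upwards [Metric.ball_mem_nhds x₀ hδ] with x hx
  have hd : ∀ y ∈ Metric.closedBall x₀ |x - x₀|,
      HasDerivWithinAt (fun y => f y - f' x₀ * y) (f' y - f' x₀) (Metric.closedBall x₀ |x - x₀|) y := by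
    intro y _
    have h := ((hf y).sub ((hasDerivAt_id y).const_mul (f' x₀))).hasDerivWithinAt
      (s := Metric.closedBall x₀ |x - x₀|)
    rw [mul_one] at h
    exact h
  have hb : ∀ y ∈ Metric.closedBall x₀ |x - x₀|, ‖f' y - f' x₀‖ ≤ C * |x - x₀| := by
    intro y hy
    have hy' : |y - x₀| ≤ |x - x₀| := by simpa [Real.dist_eq] using hy
    have hyδ : y ∈ Metric.ball x₀ δ := by
      rw [Metric.mem_ball, Real.dist_eq] at hx ⊢
      exact hy'.trans_lt hx
    exact (hball y hyδ).trans (mul_le_mul_of_nonneg_left hy' hC0.le)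
  have h := (convex_closedBall x₀ |x - x₀|).norm_image_sub_le_of_norm_hasDerivWithin_le hd hb
    (Metric.mem_closedBall_self (abs_nonneg _)) (by simp [Real.dist_eq] : x ∈ _)
  calc ‖f x - f x₀ - f' x₀ * (x - x₀)‖ = ‖f x - f' x₀ * x - (f x₀ - f' x₀ * x₀)‖ := by
        congr 1; ring
    _ ≤ _ := h
    _ = C * ‖(x - x₀) ^ 2‖ := by rw [norm_pow, Real.norm_eq_abs]; ring

theorem abs_cos_sub_le {x : ℝ} (hx : |x| ≤ 1) :
    |cos x - 1 - (-x ^ 2 / 2 + x ^ 4 / 24)| ≤ |x| ^ 6 := by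
  set y := x / 2 with hy
  have hxy : x = 2 * y := by rw [hy]; ring
  have hy1 : |y| ≤ 1 / 2 := by rw [hy, abs_div, abs_two]; linarith
  have hs := Real.sin_bound (x := y) (by linarith)
  set e := sin y - (y - y ^ 3 / 6) with he
  have hsin : sin y = y - y ^ 3 / 6 + e := by rw [he]; ring
  have hcos : cos x = 1 - 2 * sin y ^ 2 := by
    rw [hxy, Real.cos_two_mul, Real.cos_sq']; ring
  have h0 := abs_nonneg y
  have heq : cos x - 1 - (-x ^ 2 / 2 + x ^ 4 / 24) =
      -(y ^ 6 / 18) + -(4 * y * e) + 2 / 3 * y ^ 3 * e + -(2 * (e * e)) := by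
    rw [hcos, hsin, hxy]; ring
  have hA : |e| ≤ |y| ^ 5 := hs.trans (by linarith [pow_nonneg h0 5])
  have hp7 : |y| ^ 3 * |y| ^ 5 ≤ |y| ^ 6 := by
    rw [← pow_add]; exact pow_le_pow_of_le_one h0 (by linarith) (by norm_num)
  have hp10 : |y| ^ 5 * |y| ^ 5 ≤ |y| ^ 6 := by
    rw [← pow_add]; exact pow_le_pow_of_le_one h0 (by linarith) (by norm_num)
  rw [heq]
  calc _ ≤ |y| ^ 6 / 18 + 4 * |y| * |e| + 2 / 3 * |y| ^ 3 * |e| + 2 * (|e| * |e|) := by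
        refine (abs_add_le _ _).trans (add_le_add ((abs_add_le _ _).trans (add_le_add
          ((abs_add_le _ _).trans (add_le_add ?_ ?_)) ?_)) ?_) <;>
        simp [abs_mul, abs_div, abs_pow]
    _ ≤ |y| ^ 6 / 18 + 4 * |y| * |y| ^ 5 + 2 / 3 * |y| ^ 3 * |y| ^ 5 + 2 * (|y| ^ 5 * |y| ^ 5) := by
        gcongr
    _ ≤ 64 * |y| ^ 6 := by nlinarith [pow_nonneg h0 6]
    _ = |x| ^ 6 := by rw [hxy, abs_mul, mul_pow, abs_two]; norm_num

/-- Expansion of `(cos θ - 1) / (2 ε ^ 2)` along `θ = j ε + c j ε ^ 3 + σ ε ^ 4`. -/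
theorem isBigO_cos_sub_one_div (j c σ : ℝ) :
    (fun ε : ℝ => (cos (j * ε + c * j * ε ^ 3 + σ * ε ^ 4) - 1) / (2 * ε ^ 2) -
      (-j ^ 2 / 4 + -j ^ 2 / 4 * (-j ^ 2 / 4 / 3 + 2 * c) * ε ^ 2 - j * σ / 2 * ε ^ 3))
      =O[𝓝[>] 0] fun ε => ε ^ 4 := by
  set p : ℝ → ℝ := fun ε => j + c * j * ε ^ 2 + σ * ε ^ 3 with hp
  have hpc : Continuous p := by fun_prop
  have hθ : ∀ ε, j * ε + c * j * ε ^ 3 + σ * ε ^ 4 = p ε * ε := fun ε => by simp only [hp]; ring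
  simp only [hθ]
  have hpO : ∀ q : ℝ → ℝ, Continuous q → q =O[𝓝[>] 0] fun _ => (1 : ℝ) := fun q hq =>
    (hq.continuousAt.tendsto.mono_left nhdsWithin_le_nhds).isBigO_one ℝ
  have hsmall : ∀ᶠ ε in 𝓝[>] (0 : ℝ), |p ε * ε| ≤ 1 := by
    have : Tendsto (fun ε => |p ε * ε|) (𝓝 0) (𝓝 |p 0 * 0|) :=
      (by fun_prop : Continuous fun ε => |p ε * ε|).continuousAt
    rw [mul_zero, abs_zero] at this
    exact (this.mono_left nhdsWithin_le_nhds).eventually_le_const one_pos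
  have h1 : (fun ε => (cos (p ε * ε) - 1 - (-(p ε * ε) ^ 2 / 2 + (p ε * ε) ^ 4 / 24)) / (2 * ε ^ 2))
      =O[𝓝[>] 0] fun ε => ε ^ 4 := by
    have hb : (fun ε => (cos (p ε * ε) - 1 - (-(p ε * ε) ^ 2 / 2 + (p ε * ε) ^ 4 / 24)) / (2 * ε ^ 2))
        =O[𝓝[>] 0] fun ε => p ε ^ 6 * ε ^ 4 := by
      refine IsBigO.of_bound 1 ?_
      filter_upwards [hsmall, self_mem_nhdsWithin] with ε hε hε0
      have hε0' : (0 : ℝ) < ε := hε0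
      rw [norm_div, Real.norm_eq_abs, Real.norm_eq_abs, Real.norm_eq_abs,
        abs_of_pos (by positivity : 0 < 2 * ε ^ 2), div_le_iff₀ (by positivity)]
      refine (abs_cos_sub_le hε).trans ?_
      rw [abs_mul, abs_mul, abs_pow, abs_pow, mul_pow, abs_of_pos hε0']
      have : 0 ≤ |p ε| ^ 6 * ε ^ 6 := by positivity
      nlinarith
    refine hb.trans ?_
    simpa using (hpO (fun ε => p ε ^ 6) (by fun_prop)).mul (isBigO_refl (fun ε : ℝ => ε ^ 4) _)
  set q : ℝ → ℝ := fun ε => -(c * j + σ * ε) ^ 2 / 4 +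
    (4 * j ^ 3 * (c * j + σ * ε) + 6 * j ^ 2 * (c * j + σ * ε) ^ 2 * ε ^ 2 +
      4 * j * (c * j + σ * ε) ^ 3 * ε ^ 4 + (c * j + σ * ε) ^ 4 * ε ^ 6) / 48 with hq
  have h2 : (fun ε => q ε * ε ^ 4) =O[𝓝[>] 0] fun ε => ε ^ 4 := by
    simpa using (hpO q (by fun_prop)).mul (isBigO_refl (fun ε : ℝ => ε ^ 4) _)
  refine (h1.add h2).congr' ?_ EventuallyEq.rfl
  filter_upwards [self_mem_nhdsWithin] with ε hε0
  have hε0' : ε ≠ 0 := (show (0 : ℝ) < ε from hε0).ne'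
  simp only [hp, hq]
  field_simp
  ring

/-- Expansion of the first correction term `A₁` at the origin. -/
theorem isBigO_correction_sub (α β : ℝ) :
    (fun θ : ℝ => ((4 * α ^ 2 - 1) * (sin θ - θ * cos θ) +
        2 * θ * (α ^ 2 - β ^ 2) * (cos θ - 1)) / (8 * θ * sin θ) -
      (α ^ 2 + 3 * β ^ 2 - 1) / 24 * θ) =O[𝓝[>] 0] fun θ => θ ^ 2 := by
  refine IsBigO.of_bound (|4 * α ^ 2 - 1| + |α ^ 2 - β ^ 2| + |(α ^ 2 + 3 * β ^ 2 - 1) / 3|) ?_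
  have hIoo : Set.Ioo (0 : ℝ) 1 ∈ 𝓝[>] (0 : ℝ) := Ioo_mem_nhdsGT one_pos
  filter_upwards [hIoo] with θ hθ
  obtain ⟨h0, h1⟩ := hθ
  have habs : |θ| = θ := abs_of_pos h0
  have hs := Real.sin_bound (x := θ) (by rw [habs]; exact h1.le)
  have hc := Real.cos_bound (x := θ) (by rw [habs]; exact h1.le)
  rw [habs] at hs hc
  set s := sin θ - (θ - θ ^ 3 / 6) with hsdef
  set t := cos θ - (1 - θ ^ 2 / 2) with htdef
  have hsin : sin θ = θ - θ ^ 3 / 6 + s := by rw [hsdef]; ring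
  have hcos : cos θ = 1 - θ ^ 2 / 2 + t := by rw [htdef]; ring
  have p3 : θ ^ 3 ≤ θ := by simpa using pow_le_pow_of_le_one h0.le h1.le (by norm_num : 1 ≤ 3)
  have p5 : θ ^ 5 ≤ θ ^ 4 := pow_le_pow_of_le_one h0.le h1.le (by norm_num)
  have p51 : θ ^ 5 ≤ θ := by simpa using pow_le_pow_of_le_one h0.le h1.le (by norm_num : 1 ≤ 5)
  have hsl := (abs_le.1 hs).1
  have hsinpos : θ / 2 ≤ sin θ := by rw [hsin]; linarith
  have hsp : 0 < sin θ := by linarith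
  have hs' : |s| ≤ θ ^ 4 := hs.trans (by linarith [pow_pos h0 4, pow_pos h0 5])
  have ht' : |θ * t| ≤ θ ^ 4 := by
    rw [abs_mul, habs]
    calc θ * |t| ≤ θ * (θ ^ 4 * (5 / 96)) := by gcongr
      _ = θ ^ 5 * (5 / 96) := by ring
      _ ≤ _ := by linarith [pow_pos h0 4, pow_pos h0 5]
  have hu : |θ ^ 2 * (θ - sin θ)| ≤ θ ^ 4 := by
    have h2 : |θ - sin θ| ≤ θ ^ 2 := by
      have e : θ - sin θ = θ ^ 3 / 6 + -s := by rw [hsin]; ring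
      rw [e]
      have p32 : θ ^ 3 ≤ θ ^ 2 := pow_le_pow_of_le_one h0.le h1.le (by norm_num)
      have p52 : θ ^ 5 ≤ θ ^ 2 := pow_le_pow_of_le_one h0.le h1.le (by norm_num)
      refine (abs_add_le _ _).trans ?_
      rw [abs_neg, abs_of_pos (by positivity)]
      linarith [pow_pos h0 2]
    rw [abs_mul, abs_of_pos (by positivity : 0 < θ ^ 2)]
    calc θ ^ 2 * |θ - sin θ| ≤ θ ^ 2 * θ ^ 2 := by gcongr
      _ = θ ^ 4 := by ring
  have heq : ((4 * α ^ 2 - 1) * (sin θ - θ * cos θ) + 2 * θ * (α ^ 2 - β ^ 2) * (cos θ - 1)) /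
        (8 * θ * sin θ) - (α ^ 2 + 3 * β ^ 2 - 1) / 24 * θ =
      ((4 * α ^ 2 - 1) * s + (-(4 * α ^ 2 - 1)) * (θ * t) + 2 * (α ^ 2 - β ^ 2) * (θ * t) +
        (α ^ 2 + 3 * β ^ 2 - 1) / 3 * (θ ^ 2 * (θ - sin θ))) / (8 * θ * sin θ) := by
    rw [eq_div_iff (by positivity), sub_mul, div_mul_cancel₀ _ (by positivity)]
    have e1 : sin θ - θ * cos θ = θ ^ 3 / 3 + s - θ * t := by rw [hsin, hcos]; ring
    rw [e1, hcos]
    ring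
  rw [heq, norm_div, Real.norm_eq_abs, Real.norm_eq_abs, Real.norm_eq_abs,
    abs_of_pos (by positivity : 0 < 8 * θ * sin θ), abs_of_pos (by positivity : 0 < θ ^ 2),
    div_le_iff₀ (by positivity)]
  have hnum : |(4 * α ^ 2 - 1) * s + (-(4 * α ^ 2 - 1)) * (θ * t) + 2 * (α ^ 2 - β ^ 2) * (θ * t) +
      (α ^ 2 + 3 * β ^ 2 - 1) / 3 * (θ ^ 2 * (θ - sin θ))| ≤
      |4 * α ^ 2 - 1| * θ ^ 4 + |4 * α ^ 2 - 1| * θ ^ 4 + 2 * |α ^ 2 - β ^ 2| * θ ^ 4 +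
        |(α ^ 2 + 3 * β ^ 2 - 1) / 3| * θ ^ 4 := by
    refine (abs_add_le _ _).trans (add_le_add ((abs_add_le _ _).trans (add_le_add
      ((abs_add_le _ _).trans (add_le_add ?_ ?_)) ?_)) ?_)
    · rw [abs_mul]; gcongr
    · rw [abs_mul, abs_neg]; gcongr
    · rw [abs_mul, abs_mul, abs_two]; gcongr
    · rw [abs_mul]; gcongr
  refine hnum.trans ?_
  have h4 : 4 * θ ^ 4 ≤ θ ^ 2 * (8 * θ * sin θ) := by nlinarith [pow_pos h0 3]
  have hK : 0 ≤ |4 * α ^ 2 - 1| + |α ^ 2 - β ^ 2| + |(α ^ 2 + 3 * β ^ 2 - 1) / 3| := by positivity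
  have h5 := mul_le_mul_of_nonneg_left h4 hK
  have h6 := pow_pos h0 4
  have := mul_nonneg (abs_nonneg (4 * α ^ 2 - 1)) h6.le
  have := mul_nonneg (abs_nonneg (α ^ 2 - β ^ 2)) h6.le
  have := mul_nonneg (abs_nonneg ((α ^ 2 + 3 * β ^ 2 - 1) / 3)) h6.le
  nlinarith

theorem isBigO_pow_pow_nhdsGT {k l : ℕ} (h : l ≤ k) :
    (fun ε : ℝ => ε ^ k) =O[𝓝[>] 0] fun ε => ε ^ l := by
  refine IsBigO.of_bound 1 ?_
  filter_upwards [Ioo_mem_nhdsGT (one_pos (α := ℝ))] with ε hε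
  rw [one_mul, norm_pow, norm_pow, Real.norm_eq_abs, abs_of_pos hε.1]
  exact pow_le_pow_of_le_one hε.1.le hε.2.le h

theorem isBigO_hyp_sub_hypCorrection {a : ℝ} (ha : 0 < a) (ρ : ℝ) {w₀ m d : ℝ}
    (h0 : hyp a w₀ = 0) (hm : hypCorrection a ρ w₀ = 1 / a * hyp (a + 1) w₀ * m) {W : ℝ → ℝ}
    (hW : (fun ε => W ε - (w₀ + m * ε ^ 2 + d * ε ^ 3)) =O[𝓝[>] 0] fun ε => ε ^ 4) :
    (fun ε => hyp a (W ε) - ε ^ 2 * hypCorrection a ρ (W ε) -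
      1 / a * hyp (a + 1) w₀ * d * ε ^ 3) =O[𝓝[>] 0] fun ε => ε ^ 4 := by
  have hW2 : (fun ε => W ε - w₀) =O[𝓝[>] 0] fun ε => ε ^ 2 := by
    have h := (hW.trans (isBigO_pow_pow_nhdsGT (k := 4) (l := 2) (by norm_num))).add
      (((isBigO_refl (fun ε : ℝ => ε ^ 2) _).const_mul_left m).add
        ((isBigO_pow_pow_nhdsGT (k := 3) (l := 2) (by norm_num)).const_mul_left d))
    refine h.congr_left fun ε => ?_
    ring
  have hε0 : Tendsto (fun ε : ℝ => ε ^ 2) (𝓝[>] 0) (𝓝 0) := by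
    have : Tendsto (fun ε : ℝ => ε ^ 2) (𝓝 0) (𝓝 (0 ^ 2)) := (continuous_pow 2).continuousAt
    rw [zero_pow two_ne_zero] at this
    exact this.mono_left nhdsWithin_le_nhds
  have hWt : Tendsto W (𝓝[>] 0) (𝓝 w₀) := by
    have := (hW2.trans_tendsto hε0).add_const w₀
    simpa using this
  have hd : ∀ b : ℝ, 0 < b → Differentiable ℝ (hyp b) := fun b hb w =>
    (hasDerivAt_hyp hb w).differentiableAt
  have hquad : (fun ε => hyp a (W ε) - hyp a w₀ - 1 / a * hyp (a + 1) w₀ * (W ε - w₀))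
      =O[𝓝[>] 0] fun ε => ε ^ 4 := by
    have hq := isBigO_sub_sub_mul_of_hasDerivAt (x₀ := w₀) (fun x => hasDerivAt_hyp ha x)
      ((hd (a + 1) (by linarith) w₀).const_mul (1 / a))
    refine (hq.comp_tendsto hWt).trans ((hW2.pow 2).congr_right fun ε => ?_)
    ring
  have hcor : (fun ε => ε ^ 2 * (hypCorrection a ρ (W ε) - hypCorrection a ρ w₀))
      =O[𝓝[>] 0] fun ε => ε ^ 4 := by
    have hc := ((differentiable_hypCorrection ha ρ w₀).isBigO_sub.comp_tendsto hWt).trans hW2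
    refine ((isBigO_refl (fun ε : ℝ => ε ^ 2) _).mul hc).congr_right fun ε => ?_
    ring
  refine ((hquad.add (hW.const_mul_left (1 / a * hyp (a + 1) w₀))).sub hcor).congr_left fun ε => ?_
  rw [h0, hm]
  ring

/-- Up to a positive factor, `P_n^{(α,β)}(cos θ)` has the sign predicted by the Bessel function
at `θ = j / κ + c j / κ ^ 3 + σ / κ ^ 4`. -/
theorem eventually_jacobiP_mul_pos {α β j σ : ℝ} (hα : -1 < α) (hβ : -1 < β) (hj : 0 < j)
    (hjz : besselJ α j = 0) (hσ : σ ≠ 0) :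
    ∀ᶠ n : ℕ in atTop, 0 < (-σ * hyp (α + 2) (-j ^ 2 / 4)) *
      jacobiP α β n (cos (j * (1 / ((n : ℝ) + (α + β + 1) / 2)) +
        (α ^ 2 + 3 * β ^ 2 - 1) / 24 * j * (1 / ((n : ℝ) + (α + β + 1) / 2)) ^ 3 +
        σ * (1 / ((n : ℝ) + (α + β + 1) / 2)) ^ 4)) := by
  set ρ := (α + β + 1) / 2 with hρdef
  set a := α + 1 with hadef
  have ha : 0 < a := by rw [hadef]; linarith
  have hρ : -1 / 2 < ρ := by rw [hρdef]; linarith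
  set c := (α ^ 2 + 3 * β ^ 2 - 1) / 24 with hc
  set w₀ := -j ^ 2 / 4 with hw₀
  have hw₀0 : w₀ ≠ 0 := by
    have := pow_pos hj 2
    rw [hw₀]; intro h; linarith
  have hz : hyp a w₀ = 0 := hyp_eq_zero_of_besselJ_eq_zero hα hj hjz
  have hh1 : hyp (a + 1) w₀ ≠ 0 := hyp_succ_ne_zero ha hw₀0 hz
  rw [show α + 2 = a + 1 by rw [hadef]; ring]
  set H := hyp (a + 1) w₀ with hH
  set W : ℝ → ℝ := fun ε => (cos (j * ε + c * j * ε ^ 3 + σ * ε ^ 4) - 1) / (2 * ε ^ 2) with hWdef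
  have hW : (fun ε => W ε - (w₀ + w₀ * (w₀ / 3 + 2 * c) * ε ^ 2 + -(j * σ / 2) * ε ^ 3))
      =O[𝓝[>] 0] fun ε => ε ^ 4 := by
    refine (isBigO_cos_sub_one_div j c σ).congr_left fun ε => ?_
    simp only [hWdef, hw₀]
    ring
  have hm : hypCorrection a ρ w₀ = 1 / a * H * (w₀ * (w₀ / 3 + 2 * c)) := by
    rw [hypCorrection_of_hyp_eq_zero ha ρ hz, hρdef, hc, hadef]
    ring
  have hexp := isBigO_hyp_sub_hypCorrection ha ρ hz hm hW
  have hWt : ∀ᶠ ε in 𝓝[>] (0 : ℝ), |W ε| ≤ |w₀| + 1 := by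
    have h1 : (fun ε => W ε - w₀) =O[𝓝[>] 0] fun ε : ℝ => ε := by
      have h := (hW.trans (isBigO_pow_pow_nhdsGT (l := 1) (by norm_num))).add
        (((isBigO_pow_pow_nhdsGT (k := 2) (l := 1) (by norm_num)).const_mul_left (w₀ * (w₀ / 3 + 2 * c))).add
          ((isBigO_pow_pow_nhdsGT (k := 3) (l := 1) (by norm_num)).const_mul_left (-(j * σ / 2))))
      refine (h.congr_left fun ε => ?_).congr_right fun ε => pow_one ε
      ring
    have h2 : Tendsto (fun ε => |W ε - w₀|) (𝓝[>] 0) (𝓝 |0|) :=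
      (h1.trans_tendsto (tendsto_id.mono_left nhdsWithin_le_nhds)).abs
    rw [abs_zero] at h2
    filter_upwards [h2.eventually_le_const one_pos] with ε hε
    have := abs_add_le w₀ (W ε - w₀)
    rw [add_sub_cancel] at this
    linarith
  obtain ⟨C, hC⟩ := exists_abs_sum_prod_mul_hypTerm_sub_le ha hρ (|w₀| + 1)
  obtain ⟨C', hC'⟩ := hexp.bound
  have hκt : Tendsto (fun n : ℕ => (n : ℝ) + ρ) atTop atTop :=
    tendsto_atTop_add_const_right _ _ tendsto_natCast_atTop_atTop
  have hεt : Tendsto (fun n : ℕ => 1 / ((n : ℝ) + ρ)) atTop (𝓝[>] 0) := by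
    simp only [one_div]
    exact tendsto_inv_atTop_nhdsGT_zero.comp hκt
  have hlead : 0 < 1 / a * H ^ 2 * (j * σ ^ 2 / 2) := by positivity
  have hsmall : ∀ᶠ ε in 𝓝[>] (0 : ℝ),
      |σ * H| * (C + C') * ε < 1 / a * H ^ 2 * (j * σ ^ 2 / 2) := by
    have : Tendsto (fun ε : ℝ => |σ * H| * (C + C') * ε) (𝓝 0) (𝓝 (|σ * H| * (C + C') * 0)) :=
      (continuous_const_mul _).continuousAt
    rw [mul_zero] at this
    exact (this.mono_left nhdsWithin_le_nhds).eventually_lt_const hlead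
  filter_upwards [hεt.eventually hC', hεt.eventually hWt, hεt.eventually hsmall,
    hεt.eventually self_mem_nhdsWithin, eventually_ge_atTop 1] with n h1 h2 h3 h4 h5
  set ε := 1 / ((n : ℝ) + ρ) with hε
  have hε0 : 0 < ε := h4
  have hκ0 : (n : ℝ) + ρ ≠ 0 := by
    intro h
    rw [hε, h, div_zero] at hε0
    exact lt_irrefl _ hε0
  have h6 := hC n (W ε) h5 h2
  rw [jacobiP_eq_sum_hypTerm β hα n _ (κ := (n : ℝ) + ρ) rfl hκ0]
  have hw : ((n : ℝ) + ρ) ^ 2 * ((cos (j * ε + c * j * ε ^ 3 + σ * ε ^ 4) - 1) / 2) = W ε := by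
    simp only [hWdef]
    have : (n : ℝ) + ρ = 1 / ε := by rw [hε, one_div_one_div]
    rw [this]
    field_simp
  rw [hw]
  have hpre : 0 < (ascPochhammer ℝ n).eval (α + 1) / (n.factorial : ℝ) :=
    div_pos (ascPochhammer_pos n _ ha) (by positivity)
  rw [mul_left_comm]
  refine mul_pos hpre ?_
  rw [← hε] at h6
  set F := ∑ ℓ ∈ Finset.range (n + 1), (∏ i ∈ Finset.range ℓ,
    (1 - ((i : ℝ) + ρ) ^ 2 / ((n : ℝ) + ρ) ^ 2)) * hypTerm a (W ε) ℓ
  rw [Real.norm_eq_abs, Real.norm_eq_abs, abs_of_pos (pow_pos hε0 4)] at h1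
  have h7 : |F - 1 / a * H * -(j * σ / 2) * ε ^ 3| ≤ (C + C') * ε ^ 4 := by
    have := abs_add_le (F - (hyp a (W ε) - ε ^ 2 * hypCorrection a ρ (W ε)))
      (hyp a (W ε) - ε ^ 2 * hypCorrection a ρ (W ε) - 1 / a * H * -(j * σ / 2) * ε ^ 3)
    rw [sub_add_sub_cancel] at this
    linarith
  have h8 : |σ * H * (F - 1 / a * H * -(j * σ / 2) * ε ^ 3)| ≤ |σ * H| * ((C + C') * ε ^ 4) := by
    rw [abs_mul]
    gcongr
  have h9 := (abs_le.1 h8).2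
  have h10 := mul_lt_mul_of_pos_right h3 (pow_pos hε0 3)
  nlinarith

theorem jacobi_zeros_bessel_expansion (α β : ℝ) (hα : -1 < α) (hβ : -1 < β)
    (j : ℝ) (hj : 0 < j) (hjz : besselJ α j = 0) :
    ∃ C > (0 : ℝ), ∃ N : ℕ, ∀ n : ℕ, N ≤ n →
      let κ := (n : ℝ) + (α + β + 1) / 2
      let A₁ := fun θ : ℝ => ((4 * α ^ 2 - 1) * (Real.sin θ - θ * Real.cos θ) +
        2 * θ * (α ^ 2 - β ^ 2) * (Real.cos θ - 1)) / (8 * θ * Real.sin θ)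
      ∃ θstar ∈ Set.Ioo 0 π, jacobiP α β n (Real.cos θstar) = 0 ∧
        |θstar - j / κ - A₁ (j / κ) / κ ^ 2| ≤ C / κ ^ 4 := by
  obtain ⟨K, hK0, hK⟩ := (isBigO_correction_sub α β).exists_pos
  set c := (α ^ 2 + 3 * β ^ 2 - 1) / 24 with hc
  have hκt : Tendsto (fun n : ℕ => (n : ℝ) + (α + β + 1) / 2) atTop atTop :=
    tendsto_atTop_add_const_right _ _ tendsto_natCast_atTop_atTop
  have hεt : Tendsto (fun n : ℕ => 1 / ((n : ℝ) + (α + β + 1) / 2)) atTop (𝓝[>] 0) := by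
    simp only [one_div]
    exact tendsto_inv_atTop_nhdsGT_zero.comp hκt
  have hjε : Tendsto (fun ε : ℝ => j * ε) (𝓝[>] 0) (𝓝[>] 0) := by
    refine tendsto_nhdsWithin_iff.2 ⟨?_, ?_⟩
    · have : Tendsto (fun ε : ℝ => j * ε) (𝓝 0) (𝓝 (j * 0)) := (continuous_const_mul j).continuousAt
      rw [mul_zero] at this
      exact this.mono_left nhdsWithin_le_nhds
    · filter_upwards [self_mem_nhdsWithin] with ε hε
      exact mul_pos hj hε
  have hlow : ∀ᶠ ε in 𝓝[>] (0 : ℝ), 0 < j * ε + c * j * ε ^ 3 + -1 * ε ^ 4 := by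
    have : Tendsto (fun ε : ℝ => j + c * j * ε ^ 2 - ε ^ 3) (𝓝 0)
        (𝓝 (j + c * j * 0 ^ 2 - 0 ^ 3)) :=
      (by fun_prop : Continuous fun ε : ℝ => j + c * j * ε ^ 2 - ε ^ 3).continuousAt
    have h := (this.mono_left (nhdsWithin_le_nhds (s := Set.Ioi 0))).eventually_const_lt (u := 0)
      (by simpa using hj)
    filter_upwards [h, self_mem_nhdsWithin] with ε h1 hε
    have := mul_pos h1 (show (0 : ℝ) < ε from hε)
    linarith
  have hhigh : ∀ᶠ ε in 𝓝[>] (0 : ℝ), j * ε + c * j * ε ^ 3 + 1 * ε ^ 4 < π := by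
    have : Tendsto (fun ε : ℝ => j * ε + c * j * ε ^ 3 + 1 * ε ^ 4) (𝓝 0)
        (𝓝 (j * 0 + c * j * 0 ^ 3 + 1 * 0 ^ 4)) :=
      (by fun_prop : Continuous fun ε : ℝ => j * ε + c * j * ε ^ 3 + 1 * ε ^ 4).continuousAt
    exact (this.mono_left nhdsWithin_le_nhds).eventually_lt_const (by simpa using Real.pi_pos)
  refine ⟨1 + K * j ^ 2, by positivity, eventually_atTop.1 ?_⟩
  filter_upwards [eventually_jacobiP_mul_pos (σ := 1) hα hβ hj hjz one_ne_zero,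
    eventually_jacobiP_mul_pos (σ := -1) hα hβ hj hjz (by norm_num),
    hεt.eventually hlow, hεt.eventually hhigh, (hjε.comp hεt).eventually hK.bound,
    hεt.eventually self_mem_nhdsWithin] with n hp hm hlo hhi hA hε
  intro κ A₁
  simp only [Function.comp_apply] at hA
  change 0 < 1 / κ at hε
  set ε := 1 / κ with hεdef
  set H := hyp (α + 2) (-j ^ 2 / 4)
  have hcont : Continuous fun θ => -H * jacobiP α β n (cos θ) := by
    unfold jacobiP
    fun_prop
  have hle : j * ε + c * j * ε ^ 3 + -1 * ε ^ 4 ≤ j * ε + c * j * ε ^ 3 + 1 * ε ^ 4 := by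
    linarith [pow_pos hε 4]
  obtain ⟨θ, hθ, hθ0⟩ := intermediate_value_Icc hle hcont.continuousOn
    (show (0 : ℝ) ∈ Set.Icc _ _ from ⟨by linarith, by linarith⟩)
  have hH : -H ≠ 0 := by
    intro h
    rw [neg_eq_zero] at h
    simp [h] at hp
  refine ⟨θ, ⟨hlo.trans_le hθ.1, hθ.2.trans_lt hhi⟩, (mul_eq_zero.1 hθ0).resolve_left hH, ?_⟩
  have e1 : j / κ = j * ε := by rw [hεdef, mul_one_div]
  have e2 : A₁ (j / κ) / κ ^ 2 = A₁ (j * ε) * ε ^ 2 := by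
    rw [e1, hεdef, one_div, inv_pow, div_eq_mul_inv]
  have e3 : (1 + K * j ^ 2) / κ ^ 4 = (1 + K * j ^ 2) * ε ^ 4 := by
    rw [hεdef, one_div, inv_pow, div_eq_mul_inv]
  rw [e2, e3, e1]
  change |A₁ (j * ε) - c * (j * ε)| ≤ K * |(j * ε) ^ 2| at hA
  rw [abs_of_nonneg (sq_nonneg (j * ε))] at hA
  have t1 : |θ - j * ε - c * j * ε ^ 3| ≤ ε ^ 4 := by
    rw [abs_le]
    constructor <;> linarith [hθ.1, hθ.2]
  have t2 : |(A₁ (j * ε) - c * (j * ε)) * ε ^ 2| ≤ K * (j * ε) ^ 2 * ε ^ 2 := by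
    rw [abs_mul, abs_of_pos (pow_pos hε 2)]
    gcongr
  calc |θ - j * ε - A₁ (j * ε) * ε ^ 2|
      = |(θ - j * ε - c * j * ε ^ 3) - (A₁ (j * ε) - c * (j * ε)) * ε ^ 2| := by congr 1; ring
    _ ≤ |θ - j * ε - c * j * ε ^ 3| + |(A₁ (j * ε) - c * (j * ε)) * ε ^ 2| := abs_sub _ _
    _ ≤ ε ^ 4 + K * (j * ε) ^ 2 * ε ^ 2 := add_le_add t1 t2
    _ = (1 + K * j ^ 2) * ε ^ 4 := by ring
end

section
/- Let α, β be real, θ ∈ (0, π), x = cos θ, and z = e^{iθ}. Then, with principal complex powers: (a) (1 − z)^α (1 + z)^β / ((1 − x)^α (1 + x)^β) = e^{i(αθ + βθ − πα)/2} / ((sin(θ/2))^α (cos(θ/2))^β); (b) (1 − z²)/(z − x) = −2z; and (c) z is a root of z² − 2xz + 1 = 0. -/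
open Real Complex

theorem ofReal_mul_exp_cpow_ofReal {r φ : ℝ} (hr : 0 < r) (h₁ : -π < φ) (h₂ : φ ≤ π) (a : ℝ) :
    ((r : ℂ) * Complex.exp (φ * Complex.I)) ^ (a : ℂ) =
      ((r ^ a : ℝ) : ℂ) * Complex.exp (a * φ * Complex.I) := by
  have hr' : (r : ℂ) ≠ 0 := by exact_mod_cast hr.ne'
  rw [Complex.cpow_def_of_ne_zero (mul_ne_zero hr' (Complex.exp_ne_zero _)),
    Complex.log_ofReal_mul hr (Complex.exp_ne_zero _),
    Complex.log_exp (by simpa using h₁) (by simpa using h₂), Real.rpow_def_of_pos hr,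
    Complex.ofReal_exp, ← Complex.exp_add]
  congr 1
  push_cast
  ring

theorem one_add_exp_mul_I (θ : ℝ) :
    1 + Complex.exp (θ * Complex.I) =
      ((2 * Real.cos (θ / 2) : ℝ) : ℂ) * Complex.exp ((θ / 2 : ℝ) * Complex.I) := by
  push_cast
  rw [Complex.two_cos, add_mul, ← Complex.exp_add, ← Complex.exp_add, add_comm]
  ring_nf
  simp [add_comm]

theorem one_sub_exp_mul_I (θ : ℝ) :
    1 - Complex.exp (θ * Complex.I) =
      ((2 * Real.sin (θ / 2) : ℝ) : ℂ) * Complex.exp (((θ - π) / 2 : ℝ) * Complex.I) := by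
  have h := one_add_exp_mul_I (θ - π)
  rw [show (θ - π) / 2 = θ / 2 - π / 2 by ring, Real.cos_sub_pi_div_two] at h
  rw [show (θ - π) / 2 = θ / 2 - π / 2 by ring, ← h]
  push_cast
  rw [sub_mul, Complex.exp_sub, Complex.exp_pi_mul_I]
  ring

theorem saddle_point_evaluations (α β θ : ℝ) (hθ : θ ∈ Set.Ioo 0 π) :
    let x : ℝ := Real.cos θ
    let z : ℂ := Complex.exp (θ * Complex.I)
    ((1 - z) ^ (α : ℂ) * (1 + z) ^ (β : ℂ)) /
        (((1 - x) ^ α * (1 + x) ^ β : ℝ) : ℂ) =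
      Complex.exp (Complex.I * (α * θ + β * θ - π * α) / 2) /
        ((((Real.sin (θ / 2)) ^ α * (Real.cos (θ / 2)) ^ β : ℝ)) : ℂ) ∧
    (1 - z ^ 2) / (z - (x : ℂ)) = -2 * z ∧
    z ^ 2 - 2 * (x : ℂ) * z + 1 = 0 := by
  intro x z
  obtain ⟨h0, hπ⟩ := hθ
  have hs : 0 < Real.sin (θ / 2) := Real.sin_pos_of_pos_of_lt_pi (by linarith) (by linarith)
  have hc : 0 < Real.cos (θ / 2) := Real.cos_pos_of_mem_Ioo ⟨by linarith, by linarith⟩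
  have hsin : (Real.sin θ : ℂ) ≠ 0 := by
    exact_mod_cast (Real.sin_pos_of_pos_of_lt_pi h0 hπ).ne'
  have hz : z = x + Real.sin θ * Complex.I := by
    simp only [z, x, Complex.exp_mul_I, Complex.ofReal_cos, Complex.ofReal_sin]
  have hpyth : (Real.sin θ : ℂ) ^ 2 + (x : ℂ) ^ 2 = 1 := by
    exact_mod_cast Real.sin_sq_add_cos_sq θ
  have hroot : z ^ 2 - 2 * (x : ℂ) * z + 1 = 0 := by
    rw [hz]
    linear_combination (Real.sin θ : ℂ) ^ 2 * Complex.I_sq - hpyth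
  refine ⟨?_, ?_, hroot⟩
  · have hx : x = 2 * Real.cos (θ / 2) ^ 2 - 1 := by
      rw [← Real.cos_two_mul, mul_div_cancel₀ _ two_ne_zero]
    have h₁ : 1 - x = 2 * Real.sin (θ / 2) * Real.sin (θ / 2) := by
      linear_combination -hx - 2 * Real.sin_sq_add_cos_sq (θ / 2)
    have h₂ : 1 + x = 2 * Real.cos (θ / 2) * Real.cos (θ / 2) := by
      linear_combination hx
    have hsα := (Real.rpow_pos_of_pos hs α).ne'
    have hcβ := (Real.rpow_pos_of_pos hc β).ne'
    have h2sα := (Real.rpow_pos_of_pos (mul_pos two_pos hs) α).ne'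
    have h2cβ := (Real.rpow_pos_of_pos (mul_pos two_pos hc) β).ne'
    rw [h₁, h₂, Real.mul_rpow (by positivity) hs.le, Real.mul_rpow (by positivity) hc.le,
      one_sub_exp_mul_I, one_add_exp_mul_I,
      ofReal_mul_exp_cpow_ofReal (by positivity) (by linarith) (by linarith),
      ofReal_mul_exp_cpow_ofReal (by positivity) (by linarith) (by linarith),
      show Complex.I * (α * θ + β * θ - π * α) / 2 =
        α * ((θ - π) / 2 : ℝ) * Complex.I + β * (θ / 2 : ℝ) * Complex.I by push_cast; ring,
      Complex.exp_add]
    rw [← Complex.ofReal_ne_zero] at hsα hcβ h2sα h2cβ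
    simp only [Complex.ofReal_mul _ _] at *
    field_simp
  · have hne : z - (x : ℂ) ≠ 0 := by
      rw [hz, add_sub_cancel_left]
      exact mul_ne_zero hsin Complex.I_ne_zero
    rw [div_eq_iff hne]
    linear_combination hroot
end
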